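/- arXiv:2605.15960 — 5 statements merged into one kernel-verified Lean document; each statement's English description precedes it below -/
import Mathlib

section
/- Exploitability on the full stationary policy set: fix a finite task (S, A, d0, R, γ) with γ ∈ [0,1). If T and T' are transition models such that neither J_T nor J_{T'} is constant on the set of all stationary policies, and J_T, J_{T'} do not induce the same ordering on that set, then there exist stationary policies π, π' with J_T(π) > J_T(π') and J_{T'}(π') > J_{T'}(π). -/
open Matrix

/-- `p` is a probability distribution on the finite set `S`. -/
def IsDist {S : Type*} [Fintype S] (p : S → ℝ) : Prop :=
  (∀ s, 0 ≤ p s) ∧ ∑ s, p s = 1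

/-- `π` is a stationary policy: each `π s` is a distribution over actions. -/
def IsPolicy {S A : Type*} [Fintype A] (π : S → A → ℝ) : Prop :=
  ∀ s, (∀ a, 0 ≤ π s a) ∧ ∑ a, π s a = 1

/-- `T` is a transition model: each `T s a` is a distribution over next states. -/
def IsTransModel {S A : Type*} [Fintype S] (T : S → A → S → ℝ) : Prop :=
  ∀ s a, (∀ s', 0 ≤ T s a s') ∧ ∑ s', T s a s' = 1

/-- The policy-induced transition matrix `P^π(s,s') = Σ_a π(a|s) T(s'|s,a)`. -/
noncomputable def Pmat {S A : Type*} [Fintype A] (T : S → A → S → ℝ)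
    (π : S → A → ℝ) : Matrix S S ℝ :=
  Matrix.of fun s s' => ∑ a, π s a * T s a s'

/-- The policy-induced expected reward vector `r^π(s) = Σ_a π(a|s) R(s,a)`. -/
noncomputable def rvec {S A : Type*} [Fintype A] (R : S → A → ℝ)
    (π : S → A → ℝ) : S → ℝ :=
  fun s => ∑ a, π s a * R s a

/-- The policy value `J(π) = Σ_s d0(s) V^π(s)` with `V^π = (I - γ P^π)⁻¹ r^π`. -/
noncomputable def Jval {S A : Type*} [Fintype S] [Fintype A] [DecidableEq S]
    (T : S → A → S → ℝ) (R : S → A → ℝ) (d0 : S → ℝ) (γ : ℝ)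
    (π : S → A → ℝ) : ℝ :=
  ∑ s, d0 s * (((1 : Matrix S S ℝ) - γ • Pmat T π)⁻¹ *ᵥ rvec R π) s

/-- Discounted visit counts `F^π(s,a) = μ^π(s) π(a|s)` with
`μ^π = (I - γ (P^π)ᵀ)⁻¹ d0`. -/
noncomputable def visitCount {S A : Type*} [Fintype S] [Fintype A] [DecidableEq S]
    (T : S → A → S → ℝ) (d0 : S → ℝ) (γ : ℝ) (π : S → A → ℝ) :
    S → A → ℝ :=
  fun s a => ((((1 : Matrix S S ℝ) - γ • (Pmat T π)ᵀ)⁻¹) *ᵥ d0) s * π s a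

/-- The policy value written as the inner product `J(π) = ⟨R, F^π⟩`. -/
noncomputable def JvisF {S A : Type*} [Fintype S] [Fintype A] [DecidableEq S]
    (T : S → A → S → ℝ) (R : S → A → ℝ) (d0 : S → ℝ) (γ : ℝ)
    (π : S → A → ℝ) : ℝ :=
  ∑ s, ∑ a, R s a * visitCount T d0 γ π s a

/-- The interior `Π⁺` of the policy space: policies with all entries positive. -/
def PiPlus {S A : Type*} [Fintype A] : Set (S → A → ℝ) :=
  {π | IsPolicy π ∧ ∀ s a, 0 < π s a}

open Finset Filter Topology

section SubstochasticMatrix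

variable {S : Type*} [Fintype S] {Q : Matrix S S ℝ} {γ : ℝ}

/-- A nonnegative vector dominated by its own flow within `N` under a strictly substochastic
matrix vanishes on `N`. -/
theorem eq_zero_of_le_sum_mul_substochastic (hγ : γ < 1) (hQ : ∀ t s, 0 ≤ Q t s)
    (hrow : ∀ t, ∑ s, Q t s ≤ γ) (N : Finset S) (w : S → ℝ) (hw : ∀ s ∈ N, 0 ≤ w s)
    (hle : ∀ s ∈ N, w s ≤ ∑ t ∈ N, w t * Q t s) : ∀ s ∈ N, w s = 0 := by
  have hsum : ∑ s ∈ N, w s ≤ γ * ∑ s ∈ N, w s := by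
    calc ∑ s ∈ N, w s ≤ ∑ s ∈ N, ∑ t ∈ N, w t * Q t s := sum_le_sum hle
      _ = ∑ t ∈ N, w t * ∑ s ∈ N, Q t s := by
        rw [sum_comm]; simp only [mul_sum]
      _ ≤ ∑ t ∈ N, w t * γ := by
        refine sum_le_sum fun t ht => mul_le_mul_of_nonneg_left ?_ (hw t ht)
        exact (sum_le_sum_of_subset_of_nonneg (subset_univ N) fun s _ _ => hQ t s).trans (hrow t)
      _ = γ * ∑ s ∈ N, w s := by rw [← sum_mul, mul_comm]
  have h0 : 0 ≤ ∑ s ∈ N, w s := sum_nonneg hw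
  have hz : ∑ s ∈ N, w s = 0 := by nlinarith
  exact (sum_eq_zero_iff_of_nonneg hw).1 hz

theorem nonneg_of_balance (hγ : γ < 1) (hQ : ∀ t s, 0 ≤ Q t s)
    (hrow : ∀ t, ∑ s, Q t s ≤ γ) {d μ : S → ℝ} (hd : ∀ s, 0 ≤ d s)
    (hμ : ∀ s, μ s = d s + ∑ t, μ t * Q t s) (s : S) : 0 ≤ μ s := by
  classical
  by_contra! hs
  have hz := eq_zero_of_le_sum_mul_substochastic hγ hQ hrow (univ.filter fun s => μ s < 0)
    (fun s => -μ s) (fun s hs => by simp at hs; linarith) (fun s _ => by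
      have hsplit := sum_filter_add_sum_filter_not univ (fun t => μ t < 0) fun t => μ t * Q t s
      have hpos : 0 ≤ ∑ t with ¬ μ t < 0, μ t * Q t s :=
        sum_nonneg fun t ht => mul_nonneg (by simpa using ht) (hQ t s)
      have h1 := hμ s
      have h2 := hd s
      simp only [neg_mul, sum_neg_distrib]
      linarith) s (by simpa using hs)
  simp only [neg_eq_zero] at hz
  exact hs.ne hz

theorem isUnit_det_one_sub_of_substochastic [DecidableEq S] (hγ : γ < 1)
    (hQ : ∀ t s, 0 ≤ Q t s) (hrow : ∀ t, ∑ s, Q t s ≤ γ) :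
    IsUnit ((1 : Matrix S S ℝ) - Q).det := by
  rw [isUnit_iff_ne_zero]
  intro hdet
  obtain ⟨v, hv, hv0⟩ := Matrix.exists_vecMul_eq_zero_iff.2 hdet
  have hbal : ∀ s, v s = 0 + ∑ t, v t * Q t s := fun s => by
    have h := congrFun hv0 s
    rw [vecMul_sub, vecMul_one] at h
    simp only [Pi.sub_apply, vecMul, dotProduct, Pi.zero_apply] at h
    linarith
  refine hv (funext fun s => le_antisymm ?_ ?_)
  · have := nonneg_of_balance hγ hQ hrow (d := 0) (μ := -v) (fun _ => le_rfl) (fun s => by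
      have := hbal s
      simp only [Pi.neg_apply, neg_mul, sum_neg_distrib, Pi.zero_apply]
      linarith) s
    simpa using this
  · exact nonneg_of_balance hγ hQ hrow (d := 0) (fun _ => le_rfl) hbal s

end SubstochasticMatrix

section Policies

variable {S A : Type*} [Fintype A]

theorem IsPolicy.ite {π ρ : S → A → ℝ} (hπ : IsPolicy π) (hρ : IsPolicy ρ) (p : S → Prop)
    [DecidablePred p] : IsPolicy fun s => if p s then ρ s else π s := fun s => by
  by_cases h : p s
  · simpa [h] using hρ s
  · simpa [h] using hπ s

theorem convex_setOf_isPolicy : Convex ℝ {π : S → A → ℝ | IsPolicy π} := by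
  intro π hπ ρ hρ a b ha hb hab s
  refine ⟨fun i => ?_, ?_⟩
  · exact add_nonneg (mul_nonneg ha ((hπ s).1 i)) (mul_nonneg hb ((hρ s).1 i))
  · simp [sum_add_distrib, ← mul_sum, (hπ s).2, (hρ s).2, hab]

theorem IsPolicy.lineMap {π ρ : S → A → ℝ} (hπ : IsPolicy π) (hρ : IsPolicy ρ) {t : ℝ}
    (ht : t ∈ Set.Icc (0 : ℝ) 1) : IsPolicy (AffineMap.lineMap π ρ t) :=
  convex_setOf_isPolicy.lineMap_mem hπ hρ ht

end Policies

section OneStep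

variable {S A : Type*} [Fintype S] [Fintype A]
  {T : S → A → S → ℝ} {R : S → A → ℝ} {γ : ℝ}

theorem smul_Pmat_nonneg (hγ0 : 0 ≤ γ) (hT : IsTransModel T) {π : S → A → ℝ} (hπ : IsPolicy π)
    (t s : S) : 0 ≤ (γ • Pmat T π) t s :=
  mul_nonneg hγ0 (sum_nonneg fun a _ => mul_nonneg ((hπ t).1 a) ((hT t a).1 s))

theorem sum_smul_Pmat (hT : IsTransModel T) {π : S → A → ℝ} (hπ : IsPolicy π)
    (t : S) : ∑ s, (γ • Pmat T π) t s = γ := by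
  simp only [Pmat, Matrix.smul_apply, of_apply, smul_eq_mul]
  rw [← mul_sum, sum_comm]
  simp only [← mul_sum, (hT t _).2, mul_one, (hπ t).2]

/-- One-step advantage, relative to a vector `V`, of playing according to `p` at state `s`. -/
noncomputable def advantage (T : S → A → S → ℝ) (R : S → A → ℝ) (γ : ℝ) (V : S → ℝ) (s : S)
    (p : A → ℝ) : ℝ :=
  ∑ a, p a * (R s a + γ * ∑ s', T s a s' * V s') - V s

theorem advantage_lineMap (V : S → ℝ) (s : S) (p q : A → ℝ) (t : ℝ) :
    advantage T R γ V s (AffineMap.lineMap p q t) =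
      (1 - t) * advantage T R γ V s p + t * advantage T R γ V s q := by
  have h : ∀ a, (AffineMap.lineMap p q t : A → ℝ) a = (1 - t) * p a + t * q a := fun a => by
    simp [AffineMap.lineMap_apply]; ring
  simp only [advantage, h, add_mul, sum_add_distrib, mul_assoc, ← mul_sum]
  ring

end OneStep

section Value

variable {S A : Type*} [Fintype S] [Fintype A] [DecidableEq S]
  {T : S → A → S → ℝ} {R : S → A → ℝ} {d0 : S → ℝ} {γ : ℝ}

theorem isUnit_det_one_sub_smul_Pmat (hγ0 : 0 ≤ γ) (hγ1 : γ < 1) (hT : IsTransModel T)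
    {π : S → A → ℝ} (hπ : IsPolicy π) : IsUnit ((1 : Matrix S S ℝ) - γ • Pmat T π).det :=
  isUnit_det_one_sub_of_substochastic hγ1 (smul_Pmat_nonneg hγ0 hT hπ)
    fun t => (sum_smul_Pmat hT hπ t).le

/-- Discounted state occupancy of a policy. -/
noncomputable def occupancy (T : S → A → S → ℝ) (d0 : S → ℝ) (γ : ℝ) (π : S → A → ℝ) : S → ℝ :=
  d0 ᵥ* ((1 : Matrix S S ℝ) - γ • Pmat T π)⁻¹

/-- Value function of a policy. -/
noncomputable def valueFun (T : S → A → S → ℝ) (R : S → A → ℝ) (γ : ℝ) (π : S → A → ℝ) : S → ℝ :=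
  ((1 : Matrix S S ℝ) - γ • Pmat T π)⁻¹ *ᵥ rvec R π

theorem occupancy_balance (hγ0 : 0 ≤ γ) (hγ1 : γ < 1) (hT : IsTransModel T)
    {π : S → A → ℝ} (hπ : IsPolicy π) (s : S) :
    occupancy T d0 γ π s = d0 s + ∑ t, occupancy T d0 γ π t * (γ • Pmat T π) t s := by
  have h : occupancy T d0 γ π ᵥ* ((1 : Matrix S S ℝ) - γ • Pmat T π) = d0 := by
    rw [occupancy, vecMul_vecMul,
      nonsing_inv_mul _ (isUnit_det_one_sub_smul_Pmat hγ0 hγ1 hT hπ), vecMul_one]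
  have hs := congrFun h s
  rw [vecMul_sub, vecMul_one] at hs
  simp only [Pi.sub_apply, vecMul, dotProduct] at hs
  linarith

theorem occupancy_nonneg (hd0 : IsDist d0) (hγ0 : 0 ≤ γ) (hγ1 : γ < 1) (hT : IsTransModel T)
    {π : S → A → ℝ} (hπ : IsPolicy π) (s : S) : 0 ≤ occupancy T d0 γ π s :=
  nonneg_of_balance hγ1 (smul_Pmat_nonneg hγ0 hT hπ) (fun t => (sum_smul_Pmat hT hπ t).le)
    hd0.1 (occupancy_balance hγ0 hγ1 hT hπ) s

/-- States that are not visited by `π` are not visited by any policy whose actions are all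
in the support of `π`. -/
theorem occupancy_eq_zero_of_support (hd0 : IsDist d0) (hγ0 : 0 ≤ γ) (hγ1 : γ < 1)
    (hT : IsTransModel T) {π ρ : S → A → ℝ} (hπ : IsPolicy π) (hρ : IsPolicy ρ)
    (hsupp : ∀ s a, π s a = 0 → ρ s a = 0) {s : S} (hs : occupancy T d0 γ π s = 0) :
    occupancy T d0 γ ρ s = 0 := by
  classical
  refine eq_zero_of_le_sum_mul_substochastic hγ1 (smul_Pmat_nonneg hγ0 hT hρ)
    (fun t => (sum_smul_Pmat hT hρ t).le) (univ.filter fun s => occupancy T d0 γ π s = 0)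
    (occupancy T d0 γ ρ) (fun s _ => occupancy_nonneg hd0 hγ0 hγ1 hT hρ s) ?_ s (by simpa using hs)
  intro s hs
  replace hs : occupancy T d0 γ π s = 0 := by simpa using hs
  have hterm : ∀ t ∈ (univ : Finset S), 0 ≤ occupancy T d0 γ π t * (γ • Pmat T π) t s := fun t _ =>
    mul_nonneg (occupancy_nonneg hd0 hγ0 hγ1 hT hπ t) (smul_Pmat_nonneg hγ0 hT hπ t s)
  have hbal := occupancy_balance (d0 := d0) hγ0 hγ1 hT hπ s
  have hsum := sum_nonneg hterm
  have hd := hd0.1 s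
  have hflow := (sum_eq_zero_iff_of_nonneg hterm).1 (by linarith)
  rw [occupancy_balance hγ0 hγ1 hT hρ s, show d0 s = 0 by linarith, zero_add]
  refine (sum_subset (subset_univ _) fun t _ ht => ?_).ge
  replace ht : occupancy T d0 γ π t ≠ 0 := by simpa using ht
  have hP : (γ • Pmat T π) t s = 0 := (mul_eq_zero.1 (hflow t (mem_univ t))).resolve_left ht
  simp only [Pmat, Matrix.smul_apply, of_apply, smul_eq_mul, mul_eq_zero] at hP ⊢
  refine Or.inr (hP.imp_right fun hP => sum_eq_zero fun a _ => ?_)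
  have hz := (sum_eq_zero_iff_of_nonneg fun a _ =>
    mul_nonneg ((hπ t).1 a) ((hT t a).1 s)).1 hP a (mem_univ a)
  rcases mul_eq_zero.1 hz with h | h
  · rw [hsupp t a h, zero_mul]
  · rw [h, mul_zero]

theorem Jval_eq_dotProduct_valueFun (π : S → A → ℝ) :
    Jval T R d0 γ π = d0 ⬝ᵥ valueFun T R γ π := rfl

theorem Jval_neg (π : S → A → ℝ) : Jval T (-R) d0 γ π = -Jval T R d0 γ π := by
  have h : rvec (-R) π = -rvec R π := by
    ext s; simp [rvec]
  simp [Jval, h, mulVec_neg]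

theorem advantage_policy (V : S → ℝ) (π : S → A → ℝ) (s : S) :
    advantage T R γ V s (π s) =
      (rvec R π - ((1 : Matrix S S ℝ) - γ • Pmat T π) *ᵥ V) s := by
  have h : ∑ a, π s a * (γ * ∑ s', T s a s' * V s') = ((γ • Pmat T π) *ᵥ V) s := by
    simp only [mulVec, dotProduct, Pmat, Matrix.smul_apply, of_apply, smul_eq_mul, mul_sum, sum_mul]
    rw [sum_comm]
    exact sum_congr rfl fun _ _ => sum_congr rfl fun _ _ => by ring
  simp only [advantage, mul_add, sum_add_distrib, h, rvec, sub_mulVec, one_mulVec, Pi.sub_apply]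
  ring

theorem advantage_valueFun_self (hγ0 : 0 ≤ γ) (hγ1 : γ < 1) (hT : IsTransModel T)
    {π : S → A → ℝ} (hπ : IsPolicy π) (s : S) :
    advantage T R γ (valueFun T R γ π) s (π s) = 0 := by
  rw [advantage_policy, valueFun, mulVec_mulVec,
    mul_nonsing_inv _ (isUnit_det_one_sub_smul_Pmat hγ0 hγ1 hT hπ), one_mulVec, sub_self,
    Pi.zero_apply]

/-- The performance difference lemma. -/
theorem Jval_sub_Jval (hγ0 : 0 ≤ γ) (hγ1 : γ < 1) (hT : IsTransModel T)
    (π : S → A → ℝ) {ρ : S → A → ℝ} (hρ : IsPolicy ρ) :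
    Jval T R d0 γ ρ - Jval T R d0 γ π =
      ∑ s, occupancy T d0 γ ρ s * advantage T R γ (valueFun T R γ π) s (ρ s) := by
  simp only [advantage_policy]
  change _ = occupancy T d0 γ ρ ⬝ᵥ _
  rw [occupancy, ← dotProduct_mulVec, mulVec_sub, mulVec_mulVec,
    nonsing_inv_mul _ (isUnit_det_one_sub_smul_Pmat hγ0 hγ1 hT hρ), one_mulVec, dotProduct_sub]
  rfl

theorem Jval_eq_of_eq_on_visited (hγ0 : 0 ≤ γ) (hγ1 : γ < 1) (hT : IsTransModel T)
    {π ρ : S → A → ℝ} (hπ : IsPolicy π) (hρ : IsPolicy ρ)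
    (h : ∀ s, occupancy T d0 γ ρ s = 0 ∨ π s = ρ s) : Jval T R d0 γ π = Jval T R d0 γ ρ := by
  have hdiff := Jval_sub_Jval (R := R) (d0 := d0) hγ0 hγ1 hT π hρ
  rw [sum_eq_zero fun s _ => ?_] at hdiff
  · linarith
  · rcases h s with h | h
    · rw [h, zero_mul]
    · rw [← h, advantage_valueFun_self hγ0 hγ1 hT hπ, mul_zero]

theorem Jval_indicator (s : S) {π : S → A → ℝ} (hπ : IsPolicy π) :
    Jval T (fun t _ => (Pi.single s 1 : S → ℝ) t) d0 γ π = occupancy T d0 γ π s := by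
  have hr : rvec (fun t _ => (Pi.single s 1 : S → ℝ) t) π = Pi.single s 1 := by
    ext t
    simp only [rvec, ← sum_mul, (hπ t).2, one_mul]
  rw [Jval_eq_dotProduct_valueFun, valueFun, hr, dotProduct_mulVec, dotProduct_single_one,
    occupancy]

theorem occupancy_eq_of_eq_on_visited (hγ0 : 0 ≤ γ) (hγ1 : γ < 1) (hT : IsTransModel T)
    {π ρ : S → A → ℝ} (hπ : IsPolicy π) (hρ : IsPolicy ρ)
    (h : ∀ s, occupancy T d0 γ ρ s = 0 ∨ π s = ρ s) :
    occupancy T d0 γ π = occupancy T d0 γ ρ := by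
  ext s
  rw [← Jval_indicator s hπ, ← Jval_indicator s hρ]
  exact Jval_eq_of_eq_on_visited hγ0 hγ1 hT hπ hρ h

theorem continuousAt_inv_one_sub_smul_Pmat (hγ0 : 0 ≤ γ) (hγ1 : γ < 1) (hT : IsTransModel T)
    {π : S → A → ℝ} (hπ : IsPolicy π) :
    ContinuousAt (fun ρ => ((1 : Matrix S S ℝ) - γ • Pmat T ρ)⁻¹) π := by
  have hcont : Continuous fun ρ : S → A → ℝ => (1 : Matrix S S ℝ) - γ • Pmat T ρ := by
    refine continuous_matrix fun s s' => ?_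
    simp only [Pmat, Matrix.sub_apply, Matrix.smul_apply, of_apply]
    fun_prop
  refine ContinuousAt.comp (g := Inv.inv) (continuousAt_matrix_inv _ ?_) hcont.continuousAt
  rw [Ring.inverse_eq_inv']
  exact continuousAt_inv₀ (isUnit_det_one_sub_smul_Pmat hγ0 hγ1 hT hπ).ne_zero

theorem continuousAt_occupancy (hγ0 : 0 ≤ γ) (hγ1 : γ < 1) (hT : IsTransModel T)
    {π : S → A → ℝ} (hπ : IsPolicy π) (s : S) :
    ContinuousAt (fun ρ => occupancy T d0 γ ρ s) π := by
  have h : Continuous fun M : Matrix S S ℝ => (d0 ᵥ* M) s :=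
    (continuous_apply s).comp (continuous_const.matrix_vecMul continuous_id)
  exact h.continuousAt.comp (continuousAt_inv_one_sub_smul_Pmat hγ0 hγ1 hT hπ)

theorem continuousAt_Jval (hγ0 : 0 ≤ γ) (hγ1 : γ < 1) (hT : IsTransModel T)
    {π : S → A → ℝ} (hπ : IsPolicy π) : ContinuousAt (Jval T R d0 γ) π := by
  have hr : Continuous (rvec R : (S → A → ℝ) → S → ℝ) := by
    unfold rvec; fun_prop
  have h : Continuous fun p : Matrix S S ℝ × (S → ℝ) => d0 ⬝ᵥ (p.1 *ᵥ p.2) :=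
    continuous_const.dotProduct (continuous_fst.matrix_mulVec continuous_snd)
  exact ContinuousAt.comp
    (f := fun ρ => (((1 : Matrix S S ℝ) - γ • Pmat T ρ)⁻¹, rvec R ρ)) h.continuousAt
    ((continuousAt_inv_one_sub_smul_Pmat hγ0 hγ1 hT hπ).prodMk hr.continuousAt)

/-- A locally optimal policy is at least as good as any policy with which it agrees on the
states that it does not visit itself, as far as the other policy visits them. -/
theorem Jval_le_of_isLocalMaxOn (hd0 : IsDist d0) (hγ0 : 0 ≤ γ) (hγ1 : γ < 1)
    (hT : IsTransModel T) {π ρ : S → A → ℝ} (hπ : IsPolicy π) (hρ : IsPolicy ρ)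
    (hmax : IsLocalMaxOn (Jval T R d0 γ) {σ | IsPolicy σ} π)
    (h : ∀ s, occupancy T d0 γ π s = 0 → occupancy T d0 γ ρ s = 0 ∨ π s = ρ s) :
    Jval T R d0 γ ρ ≤ Jval T R d0 γ π := by
  rw [← sub_nonpos, Jval_sub_Jval hγ0 hγ1 hT π hρ]
  refine sum_nonpos fun s _ => ?_
  by_cases hs : occupancy T d0 γ π s = 0
  · rcases h s hs with h | h
    · rw [h, zero_mul]
    · rw [← h, advantage_valueFun_self hγ0 hγ1 hT hπ, mul_zero]
  refine mul_nonpos_of_nonneg_of_nonpos (occupancy_nonneg hd0 hγ0 hγ1 hT hρ s) ?_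
  have hpos : 0 < occupancy T d0 γ π s :=
    (occupancy_nonneg hd0 hγ0 hγ1 hT hπ s).lt_of_ne' hs
  let σ : ℝ → S → A → ℝ := fun t => Function.update π s (AffineMap.lineMap (π s) (ρ s) t)
  have hσ0 : σ 0 = π := by simp [σ]
  have hσc : Continuous σ :=
    continuous_const.update s AffineMap.lineMap_continuous
  have hσp : ∀ t ∈ Set.Icc (0 : ℝ) 1, IsPolicy (σ t) := fun t ht s' => by
    by_cases hs' : s' = s
    · subst hs'
      have hline := hπ.lineMap hρ ht s'
      simpa [σ, AffineMap.lineMap_apply] using hline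
    · simpa [σ, hs'] using hπ s'
  have hlim : Tendsto σ (𝓝[>] 0) (𝓝 π) := by
    simpa [hσ0] using (hσc.tendsto 0).mono_left nhdsWithin_le_nhds
  have hIoc : ∀ᶠ t : ℝ in 𝓝[>] 0, t ∈ Set.Ioc (0 : ℝ) 1 := Ioc_mem_nhdsGT one_pos
  have hlim' : Tendsto σ (𝓝[>] 0) (𝓝[{σ | IsPolicy σ}] π) :=
    tendsto_nhdsWithin_iff.2 ⟨hlim, hIoc.mono fun t ht => hσp t ⟨ht.1.le, ht.2⟩⟩
  have hocc : ∀ᶠ t in 𝓝[>] 0, 0 < occupancy T d0 γ (σ t) s :=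
    hlim.eventually ((continuousAt_occupancy hγ0 hγ1 hT hπ s).eventually (lt_mem_nhds hpos))
  obtain ⟨t, ht, hpos_t, hle⟩ := (hIoc.and (hocc.and (hlim'.eventually hmax))).exists
  have hdiff := Jval_sub_Jval (R := R) (d0 := d0) hγ0 hγ1 hT π (hσp t ⟨ht.1.le, ht.2⟩)
  rw [sum_eq_single_of_mem s (mem_univ s) fun s' _ hs' => by
    simp only [σ, Function.update_of_ne hs', advantage_valueFun_self hγ0 hγ1 hT hπ, mul_zero]]
    at hdiff
  simp only [σ, Function.update_self, advantage_lineMap, advantage_valueFun_self hγ0 hγ1 hT hπ,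
    mul_zero, zero_add] at hdiff
  by_contra! hadv
  have := mul_pos hpos_t (mul_pos ht.1 hadv)
  simp only [σ] at this hle
  linarith

end Value

section Unexploitable

variable {S A : Type*} [Fintype S] [Fintype A] [DecidableEq S]
  {T T' : S → A → S → ℝ} {d0 : S → ℝ} {γ : ℝ} {R : S → A → ℝ}

/-- If an unexploitable pair separates two `J_T`-equivalent policies, then these maximize `J_T`.
Redirecting the worse one on the states it does not visit gives either a local maximum that already
bounds `J_T`, or a segment with a policy near which `J_T` is constant. -/
theorem Jval_le_of_unexploitable (hd0 : IsDist d0) (hγ0 : 0 ≤ γ) (hγ1 : γ < 1)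
    (hT : IsTransModel T) (hT' : IsTransModel T')
    (hunexp : ∀ π π' : S → A → ℝ, IsPolicy π → IsPolicy π' →
      Jval T R d0 γ π' < Jval T R d0 γ π → Jval T' R d0 γ π' ≤ Jval T' R d0 γ π)
    {α β : S → A → ℝ} (hα : IsPolicy α) (hβ : IsPolicy β)
    (heq : Jval T R d0 γ α = Jval T R d0 γ β) (hlt : Jval T' R d0 γ α < Jval T' R d0 γ β)
    {ρ : S → A → ℝ} (hρ : IsPolicy ρ) : Jval T R d0 γ ρ ≤ Jval T R d0 γ α := by
  classical
  have hloc_max : ∀ σ, IsPolicy σ → Jval T R d0 γ σ = Jval T R d0 γ α →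
      Jval T' R d0 γ σ < Jval T' R d0 γ β →
      IsLocalMaxOn (Jval T R d0 γ) {σ | IsPolicy σ} σ := fun σ hσ hJ hJ' => by
    filter_upwards [self_mem_nhdsWithin, nhdsWithin_le_nhds
      ((continuousAt_Jval hγ0 hγ1 hT' hσ).eventually (gt_mem_nhds hJ'))] with τ hτ hτ'
    by_contra! hc
    exact absurd (hunexp τ β hτ hβ (by linarith)) (not_le.2 hτ')
  have hloc_min : ∀ σ, IsPolicy σ → Jval T R d0 γ σ = Jval T R d0 γ α →
      Jval T' R d0 γ α < Jval T' R d0 γ σ →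
      IsLocalMinOn (Jval T R d0 γ) {σ | IsPolicy σ} σ := fun σ hσ hJ hJ' => by
    filter_upwards [self_mem_nhdsWithin, nhdsWithin_le_nhds
      ((continuousAt_Jval hγ0 hγ1 hT' hσ).eventually (lt_mem_nhds hJ'))] with τ hτ hτ'
    by_contra! hc
    exact absurd (hunexp α τ hα hτ (by linarith)) (not_le.2 hτ')
  let α' : S → A → ℝ := fun s => if occupancy T d0 γ α s = 0 then ρ s else α s
  have hα' : IsPolicy α' := hα.ite hρ _
  have hpath : ∀ t ∈ Set.Icc (0 : ℝ) 1, Jval T R d0 γ (AffineMap.lineMap α α' t) =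
      Jval T R d0 γ α := fun t ht =>
    Jval_eq_of_eq_on_visited hγ0 hγ1 hT (hα.lineMap hα' ht) hα fun s => by
      by_cases hs : occupancy T d0 γ α s = 0
      · exact Or.inl hs
      · right
        simp [AffineMap.lineMap_apply, α', hs]
  have hJα' : Jval T R d0 γ α' = Jval T R d0 γ α := by
    simpa using hpath 1 (by simp)
  by_cases hcase : Jval T' R d0 γ α' < Jval T' R d0 γ β
  · rw [← hJα']
    refine Jval_le_of_isLocalMaxOn hd0 hγ0 hγ1 hT hα' hρ (hloc_max α' hα' hJα' hcase) fun s hs => ?_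
    rw [occupancy_eq_of_eq_on_visited hγ0 hγ1 hT hα' hα fun s => by
      by_cases hs : occupancy T d0 γ α s = 0 <;> simp [α', hs]] at hs
    right
    simp [α', hs]
  have hcont : ContinuousOn (fun t : ℝ => Jval T' R d0 γ (AffineMap.lineMap α α' t))
      (Set.Icc 0 1) := fun t ht =>
    (ContinuousAt.comp (continuousAt_Jval hγ0 hγ1 hT' (hα.lineMap hα' ht))
      AffineMap.lineMap_continuous.continuousAt).continuousWithinAt
  obtain ⟨t, ht, hmid⟩ := intermediate_value_Icc zero_le_one hcont
    (show (Jval T' R d0 γ α + Jval T' R d0 γ β) / 2 ∈ _ by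
      simp only [AffineMap.lineMap_apply_zero, AffineMap.lineMap_apply_one, Set.mem_Icc]
      constructor <;> linarith)
  set σ : S → A → ℝ := AffineMap.lineMap α α' t
  have hσ : IsPolicy σ := hα.lineMap hα' ht
  have hJσ : Jval T R d0 γ σ = Jval T R d0 γ α := hpath t ht
  simp only at hmid
  have hconst : ∀ᶠ τ in 𝓝[{σ | IsPolicy σ}] σ, Jval T R d0 γ τ = Jval T R d0 γ α := by
    filter_upwards [hloc_max σ hσ hJσ (by linarith), hloc_min σ hσ hJσ (by linarith)] with τ h1 h2
    exact (le_antisymm h1 h2).trans hJσ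
  have hIoc : ∀ᶠ ε : ℝ in 𝓝[>] 0, ε ∈ Set.Ioc (0 : ℝ) 1 := Ioc_mem_nhdsGT one_pos
  have hlim : Tendsto (fun ε : ℝ => (AffineMap.lineMap σ ρ ε : S → A → ℝ)) (𝓝[>] 0)
      (𝓝[{σ | IsPolicy σ}] σ) := by
    refine tendsto_nhdsWithin_iff.2 ⟨?_, hIoc.mono fun ε hε => hσ.lineMap hρ ⟨hε.1.le, hε.2⟩⟩
    have h := (AffineMap.lineMap_continuous (R := ℝ) (p := σ) (q := ρ)).tendsto 0
    rw [AffineMap.lineMap_apply_zero] at h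
    exact h.mono_left nhdsWithin_le_nhds
  obtain ⟨ε, hε, hJτ, hconst_τ⟩ := (hIoc.and ((hlim.eventually hconst).and
    (hlim.eventually (eventually_eventually_nhdsWithin.2 hconst)))).exists
  set τ : S → A → ℝ := AffineMap.lineMap σ ρ ε with hτ_def
  have hτ : IsPolicy τ := hσ.lineMap hρ ⟨hε.1.le, hε.2⟩
  rw [← hJτ]
  refine Jval_le_of_isLocalMaxOn hd0 hγ0 hγ1 hT hτ hρ
    (hconst_τ.mono fun υ hυ => (hυ.trans hJτ.symm).le) fun s hs => Or.inl ?_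
  refine occupancy_eq_zero_of_support hd0 hγ0 hγ1 hT hτ hρ (fun s a hsa => ?_) hs
  have hval : τ s a = (1 - ε) * σ s a + ε * ρ s a := by
    simp [hτ_def, AffineMap.lineMap_apply]; ring
  have hσ_nonneg := mul_nonneg (sub_nonneg.2 hε.2) ((hσ s).1 a)
  have hρ_nonneg := mul_nonneg hε.1.le ((hρ s).1 a)
  exact (mul_eq_zero.1 (show ε * ρ s a = 0 by linarith)).resolve_left (ne_of_gt hε.1)

/-- A pair of models, the first one non-trivial, that separates two `J_T`-equivalent policies is
exploitable. -/
theorem exists_exploit_of_separated (hd0 : IsDist d0) (hγ0 : 0 ≤ γ) (hγ1 : γ < 1)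
    (hT : IsTransModel T) (hT' : IsTransModel T')
    (hnc : ∃ π π' : S → A → ℝ, IsPolicy π ∧ IsPolicy π' ∧
      Jval T R d0 γ π ≠ Jval T R d0 γ π')
    {α β : S → A → ℝ} (hα : IsPolicy α) (hβ : IsPolicy β)
    (heq : Jval T R d0 γ α = Jval T R d0 γ β) (hlt : Jval T' R d0 γ α < Jval T' R d0 γ β) :
    ∃ π π' : S → A → ℝ, IsPolicy π ∧ IsPolicy π' ∧
      Jval T R d0 γ π' < Jval T R d0 γ π ∧ Jval T' R d0 γ π < Jval T' R d0 γ π' := by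
  by_contra! hunexp
  have hconst : ∀ ρ, IsPolicy ρ → Jval T R d0 γ ρ = Jval T R d0 γ α := fun ρ hρ => by
    refine le_antisymm
      (Jval_le_of_unexploitable hd0 hγ0 hγ1 hT hT' hunexp hα hβ heq hlt hρ) ?_
    have h := Jval_le_of_unexploitable (R := -R) hd0 hγ0 hγ1 hT hT'
      (fun π π' hπ hπ' h => by
        simp only [Jval_neg, neg_lt_neg_iff, neg_le_neg_iff] at h ⊢
        exact hunexp π' π hπ' hπ h)
      hβ hα (by simp only [Jval_neg, heq]) (by simpa only [Jval_neg, neg_lt_neg_iff] using hlt) hρ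
    simp only [Jval_neg, neg_le_neg_iff] at h
    exact heq.trans_le h
  obtain ⟨π, π', hπ, hπ', hne⟩ := hnc
  exact hne ((hconst π hπ).trans (hconst π' hπ').symm)

end Unexploitable

/-- **Exploitability on the full stationary policy set**: every non-trivial,
non-equivalent pair of transition models is exploitable on the set of all
stationary policies. -/
theorem stmt10 {S A : Type*} [Fintype S] [Fintype A] [DecidableEq S] [Nonempty S]
    (hA : 1 < Fintype.card A)
    (d0 : S → ℝ) (hd0 : IsDist d0) (R : S → A → ℝ)
    (γ : ℝ) (hγ0 : 0 ≤ γ) (hγ1 : γ < 1)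
    (T T' : S → A → S → ℝ) (hT : IsTransModel T) (hT' : IsTransModel T')
    -- `J_T` is non-constant on the set of all stationary policies
    (hnc : ∃ π π' : S → A → ℝ, IsPolicy π ∧ IsPolicy π' ∧
      Jval T R d0 γ π ≠ Jval T R d0 γ π')
    -- `J_{T'}` is non-constant on the set of all stationary policies
    (hnc' : ∃ π π' : S → A → ℝ, IsPolicy π ∧ IsPolicy π' ∧
      Jval T' R d0 γ π ≠ Jval T' R d0 γ π')
    -- `J_T` and `J_{T'}` do not induce the same ordering there
    (hneq : ¬ ∀ π π' : S → A → ℝ, IsPolicy π → IsPolicy π' →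
      (Jval T R d0 γ π' ≤ Jval T R d0 γ π ↔
        Jval T' R d0 γ π' ≤ Jval T' R d0 γ π)) :
    ∃ π π' : S → A → ℝ, IsPolicy π ∧ IsPolicy π' ∧
      Jval T R d0 γ π' < Jval T R d0 γ π ∧
      Jval T' R d0 γ π < Jval T' R d0 γ π' := by
  by_contra hunexp
  refine hneq fun π π' hπ hπ' => ⟨fun h => ?_, fun h => ?_⟩
  · by_contra! hlt
    rcases h.lt_or_eq with h | h
    · exact hunexp ⟨π, π', hπ, hπ', h, hlt⟩
    · exact hunexp (exists_exploit_of_separated hd0 hγ0 hγ1 hT hT' hnc hπ hπ' h.symm hlt)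
  · by_contra! hlt
    rcases h.lt_or_eq with h | h
    · exact hunexp ⟨π', π, hπ', hπ, hlt, h⟩
    · obtain ⟨σ, σ', hσ, hσ', h1, h2⟩ :=
        exists_exploit_of_separated hd0 hγ0 hγ1 hT' hT hnc' hπ hπ' h.symm hlt
      exact hunexp ⟨σ', σ, hσ', hσ, h2, h1⟩
end

section
/- Exploitability on δ-deterministic policies: fix a finite task (S, A, d0, R, γ) with γ ∈ [0,1) and let δ < 1. Let Π_δ be the set of stationary policies π with max_a π(a|s) ≥ δ for every s ∈ S. If T and T' are transition models such that neither J_T nor J_{T'} is constant on Π_δ, and J_T, J_{T'} do not induce the same ordering on Π_δ, then there exist π, π' ∈ Π_δ with J_T(π) > J_T(π') and J_{T'}(π') > J_{T'}(π). -/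
open Matrix

/-- The set of δ-deterministic stationary policies: `max_a π(a|s) ≥ δ` for
every state `s` (equivalently, some action has probability at least `δ`). -/
def DeltaDet {S A : Type*} [Fintype A] (δ : ℝ) : Set (S → A → ℝ) :=
  {π | IsPolicy π ∧ ∀ s, ∃ a, δ ≤ π s a}

/-- The point at parameter `t` on the segment from `y` to `x`. -/
def policySegment {S A : Type*} (y x : S → A → ℝ) (t : ℝ) : S → A → ℝ :=
  fun s a => (1 - t) * y s a + t * x s a

@[simp] lemma policySegment_zero {S A : Type*} (y x : S → A → ℝ) : policySegment y x 0 = y := by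
  ext s a; simp [policySegment]

@[simp] lemma policySegment_one {S A : Type*} (y x : S → A → ℝ) : policySegment y x 1 = x := by
  ext s a; simp [policySegment]

section Segment

variable {S A : Type*} [Fintype A]

lemma IsPolicy.policySegment {y x : S → A → ℝ} (hy : IsPolicy y) (hx : IsPolicy x)
    {t : ℝ} (ht0 : 0 ≤ t) (ht1 : t ≤ 1) : IsPolicy (policySegment y x t) := by
  intro s
  refine ⟨fun a => ?_, ?_⟩
  · have h1 := (hy s).1 a
    have h2 := (hx s).1 a
    have h3 : 0 ≤ 1 - t := by linarith
    unfold _root_.policySegment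
    positivity
  · simp only [_root_.policySegment, Finset.sum_add_distrib, ← Finset.mul_sum, (hy s).2, (hx s).2]
    ring

lemma Pmat_policySegment (T : S → A → S → ℝ) (y x : S → A → ℝ) (t : ℝ) (i j : S) :
    Pmat T (policySegment y x t) i j = (1 - t) * Pmat T y i j + t * Pmat T x i j := by
  simp only [Pmat, policySegment, Matrix.of_apply, Finset.mul_sum, ← Finset.sum_add_distrib]
  exact Finset.sum_congr rfl fun a _ => by ring

lemma rvec_policySegment (R : S → A → ℝ) (y x : S → A → ℝ) (t : ℝ) (i : S) :
    rvec R (policySegment y x t) i = (1 - t) * rvec R y i + t * rvec R x i := by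
  simp only [rvec, policySegment, Finset.mul_sum, ← Finset.sum_add_distrib]
  exact Finset.sum_congr rfl fun a _ => by ring

lemma eventually_policySegment_mem_DeltaDet [Finite S] {δ : ℝ} {y x : S → A → ℝ} (a₀ : A)
    (hy : IsPolicy y) (hyδ : ∀ s, δ < y s a₀) (hx : IsPolicy x) :
    ∀ᶠ t in nhdsWithin (0 : ℝ) (Set.Ioi 0), policySegment y x t ∈ DeltaDet δ := by
  have hlt : ∀ᶠ t in nhdsWithin (0 : ℝ) (Set.Ioi 0), t < 1 :=
    nhdsWithin_le_nhds (Iio_mem_nhds one_pos)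
  have hev : ∀ s, ∀ᶠ t in nhdsWithin (0 : ℝ) (Set.Ioi 0), δ < policySegment y x t s a₀ := by
    intro s
    have hc : Continuous fun t => policySegment y x t s a₀ := by
      unfold policySegment; fun_prop
    have h0 : δ < policySegment y x 0 s a₀ := by simpa using hyδ s
    exact nhdsWithin_le_nhds (hc.tendsto 0 (Ioi_mem_nhds h0))
  filter_upwards [hlt, self_mem_nhdsWithin, Filter.eventually_all.2 hev] with t h1 h0 hs
  exact ⟨hy.policySegment hx (le_of_lt h0) h1.le, fun s => ⟨a₀, (hs s).le⟩⟩

end Segment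

section Value

variable {S A : Type*} [Fintype S] [Fintype A] [DecidableEq S]

lemma det_one_sub_smul_Pmat_ne_zero {T : S → A → S → ℝ} (hT : IsTransModel T)
    {γ : ℝ} (hγ0 : 0 ≤ γ) (hγ1 : γ < 1) {π : S → A → ℝ} (hπ : IsPolicy π) :
    ((1 : Matrix S S ℝ) - γ • Pmat T π).det ≠ 0 := by
  have hP0 : ∀ i j, 0 ≤ Pmat T π i j := fun i j =>
    Finset.sum_nonneg fun a _ => mul_nonneg ((hπ i).1 a) ((hT i a).1 j)
  have hP1 : ∀ i, ∑ j, Pmat T π i j = 1 := by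
    intro i
    simp only [Pmat, Matrix.of_apply]
    rw [Finset.sum_comm]
    simp only [← Finset.mul_sum, (hT i _).2, mul_one, (hπ i).2]
  apply det_ne_zero_of_sum_row_lt_diag
  intro k
  have hsum : ∑ j ∈ Finset.univ.erase k, ‖((1 : Matrix S S ℝ) - γ • Pmat T π) k j‖
      = γ * ∑ j ∈ Finset.univ.erase k, Pmat T π k j := by
    rw [Finset.mul_sum]
    refine Finset.sum_congr rfl fun j hj => ?_
    have hjk : k ≠ j := (Finset.ne_of_mem_erase hj).symm
    simp [Matrix.one_apply_ne hjk, abs_of_nonneg hγ0, abs_of_nonneg (hP0 k j)]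
  have hsplit := Finset.add_sum_erase Finset.univ (fun j => Pmat T π k j) (Finset.mem_univ k)
  simp only [hP1 k] at hsplit
  rw [hsum, Real.norm_eq_abs]
  refine lt_of_lt_of_le ?_ (le_abs_self _)
  simp only [Matrix.sub_apply, Matrix.one_apply_eq, Matrix.smul_apply, smul_eq_mul]
  nlinarith

/-- Along a segment of policies the value is a quotient of two polynomials in the parameter. -/
lemma exists_polynomial_Jval_policySegment {T : S → A → S → ℝ} (hT : IsTransModel T)
    (R : S → A → ℝ) (d0 : S → ℝ) {γ : ℝ} (hγ0 : 0 ≤ γ) (hγ1 : γ < 1)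
    {y x : S → A → ℝ} (hy : IsPolicy y) (hx : IsPolicy x) :
    ∃ N D : Polynomial ℝ, (∀ t, 0 ≤ t → t ≤ 1 → D.eval t ≠ 0) ∧
      ∀ t, Jval T R d0 γ (policySegment y x t) = N.eval t / D.eval t := by
  let M : Matrix S S (Polynomial ℝ) := Matrix.of fun i j =>
    Polynomial.C ((1 : Matrix S S ℝ) i j) - Polynomial.C γ *
      ((1 - Polynomial.X) * Polynomial.C (Pmat T y i j) +
        Polynomial.X * Polynomial.C (Pmat T x i j))
  let ρ : S → Polynomial ℝ := fun i =>
    (1 - Polynomial.X) * Polynomial.C (rvec R y i) + Polynomial.X * Polynomial.C (rvec R x i)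
  have hM : ∀ t, (Polynomial.evalRingHom t).mapMatrix M =
      (1 : Matrix S S ℝ) - γ • Pmat T (policySegment y x t) := by
    intro t
    ext i j
    simp [M, Pmat_policySegment, mul_comm t]
  have hdet : ∀ t, M.det.eval t =
      ((1 : Matrix S S ℝ) - γ • Pmat T (policySegment y x t)).det := by
    intro t
    rw [← hM, ← RingHom.map_det, Polynomial.coe_evalRingHom]
  have hadj : ∀ t i j, (M.adjugate i j).eval t =
      ((1 : Matrix S S ℝ) - γ • Pmat T (policySegment y x t)).adjugate i j := by
    intro t i j
    rw [← hM, ← RingHom.map_adjugate]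
    simp
  refine ⟨∑ i, Polynomial.C (d0 i) * ∑ j, M.adjugate i j * ρ j, M.det, ?_, ?_⟩
  · intro t ht0 ht1
    rw [hdet]
    exact det_one_sub_smul_Pmat_ne_zero hT hγ0 hγ1 (hy.policySegment hx ht0 ht1)
  · intro t
    have hρ : ∀ i, (ρ i).eval t = rvec R (policySegment y x t) i := by
      intro i
      simp [ρ, rvec_policySegment, mul_comm t]
    simp only [Jval, Matrix.inv_def, Ring.inverse_eq_inv', Polynomial.eval_finsetSum,
      Polynomial.eval_mul, Polynomial.eval_C, hdet, hadj, hρ, Matrix.smul_mulVec,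
      Pi.smul_apply, smul_eq_mul]
    rw [Finset.sum_div]
    simp only [Matrix.mulVec, dotProduct]
    exact Finset.sum_congr rfl fun i _ => by ring

lemma tendsto_Jval_policySegment {T : S → A → S → ℝ} (hT : IsTransModel T)
    (R : S → A → ℝ) (d0 : S → ℝ) {γ : ℝ} (hγ0 : 0 ≤ γ) (hγ1 : γ < 1)
    {y x : S → A → ℝ} (hy : IsPolicy y) (hx : IsPolicy x) :
    Filter.Tendsto (fun t => Jval T R d0 γ (policySegment y x t)) (nhds 0)
      (nhds (Jval T R d0 γ y)) := by
  obtain ⟨N, D, hD, hJ⟩ := exists_polynomial_Jval_policySegment hT R d0 hγ0 hγ1 hy hx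
  have h0 := hJ 0
  rw [policySegment_zero] at h0
  rw [h0]
  simp only [hJ]
  exact (N.continuous.tendsto 0).div (D.continuous.tendsto 0) (hD 0 le_rfl zero_le_one)

/-- A bilinear relation between two value functions that holds near the start of a segment of
policies holds at its end. -/
lemma bilinear_relation_of_eventually {T T' : S → A → S → ℝ} (hT : IsTransModel T)
    (hT' : IsTransModel T') (R : S → A → ℝ) (d0 : S → ℝ) {γ : ℝ} (hγ0 : 0 ≤ γ) (hγ1 : γ < 1)
    {y x : S → A → ℝ} (hy : IsPolicy y) (hx : IsPolicy x) (a b c d : ℝ)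
    (h : ∀ᶠ t in nhdsWithin (0 : ℝ) (Set.Ioi 0),
      a * Jval T R d0 γ (policySegment y x t) * Jval T' R d0 γ (policySegment y x t) +
        b * Jval T R d0 γ (policySegment y x t) +
        c * Jval T' R d0 γ (policySegment y x t) + d = 0) :
    a * Jval T R d0 γ x * Jval T' R d0 γ x + b * Jval T R d0 γ x +
      c * Jval T' R d0 γ x + d = 0 := by
  obtain ⟨N, D, hD, hJ⟩ := exists_polynomial_Jval_policySegment hT R d0 hγ0 hγ1 hy hx
  obtain ⟨N', D', hD', hJ'⟩ := exists_polynomial_Jval_policySegment hT' R d0 hγ0 hγ1 hy hx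
  let Q : Polynomial ℝ := Polynomial.C a * N * N' + Polynomial.C b * N * D' +
    Polynomial.C c * N' * D + Polynomial.C d * D * D'
  have hQ : ∀ t, 0 ≤ t → t ≤ 1 → Q.eval t = D.eval t * D'.eval t *
      (a * Jval T R d0 γ (policySegment y x t) * Jval T' R d0 γ (policySegment y x t) +
        b * Jval T R d0 γ (policySegment y x t) +
        c * Jval T' R d0 γ (policySegment y x t) + d) := by
    intro t ht0 ht1
    have h1 := hD t ht0 ht1
    have h2 := hD' t ht0 ht1
    rw [hJ, hJ']
    simp only [Q, Polynomial.eval_add, Polynomial.eval_mul, Polynomial.eval_C]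
    field_simp
  have hev : ∀ᶠ t in nhdsWithin (0 : ℝ) (Set.Ioi 0), Q.eval t = 0 := by
    have hlt : ∀ᶠ t in nhdsWithin (0 : ℝ) (Set.Ioi 0), t < 1 :=
      nhdsWithin_le_nhds (Iio_mem_nhds one_pos)
    filter_upwards [h, self_mem_nhdsWithin, hlt] with t ht ht0 ht1
    rw [hQ t (le_of_lt ht0) ht1.le, ht, mul_zero]
  have hQ0 : Q = 0 := by
    refine Polynomial.eq_zero_of_infinite_isRoot Q ?_
    obtain ⟨ε, hε, hsub⟩ := mem_nhdsGT_iff_exists_Ioo_subset.1 hev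
    exact (Set.Ioo_infinite hε).mono hsub
  have h1 := hQ 1 zero_le_one le_rfl
  rw [hQ0, Polynomial.eval_zero, policySegment_one] at h1
  exact (mul_eq_zero.1 h1.symm).resolve_left
    (mul_ne_zero (hD 1 zero_le_one le_rfl) (hD' 1 zero_le_one le_rfl))

/-- Along a segment of policies that differ in a single state the value is a linear-fractional
function of the parameter. -/
lemma exists_Jval_policySegment_eq_linearFractional {T : S → A → S → ℝ} (hT : IsTransModel T)
    (R : S → A → ℝ) (d0 : S → ℝ) {γ : ℝ} (hγ0 : 0 ≤ γ) (hγ1 : γ < 1)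
    {u w : S → A → ℝ} (hu : IsPolicy u) (hw : IsPolicy w) (s : S)
    (huw : ∀ i, i ≠ s → w i = u i) :
    ∃ m κ : ℝ, ∀ t, 0 ≤ t → t ≤ 1 → 0 < 1 + t * κ ∧
      Jval T R d0 γ (policySegment u w t) = Jval T R d0 γ u + t * m / (1 + t * κ) := by
  let M : ℝ → Matrix S S ℝ := fun t => 1 - γ • Pmat T (policySegment u w t)
  have hdet : ∀ t, 0 ≤ t → t ≤ 1 → IsUnit (M t).det := fun t ht0 ht1 =>
    (det_one_sub_smul_Pmat_ne_zero hT hγ0 hγ1 (hu.policySegment hw ht0 ht1)).isUnit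
  have hdet0 := hdet 0 le_rfl zero_le_one
  let k : S → ℝ := fun j => -γ * (Pmat T w s j - Pmat T u s j)
  let ρ : ℝ := rvec R w s - rvec R u s
  have hMt : ∀ t v, M t *ᵥ v = M 0 *ᵥ v + (t * (k ⬝ᵥ v)) • Pi.single s 1 := by
    intro t v
    have hrow : M t = M 0 + t • Matrix.vecMulVec (Pi.single s 1) k := by
      ext i j
      simp only [M, Matrix.add_apply, Matrix.sub_apply, Matrix.smul_apply, smul_eq_mul,
        Pmat_policySegment, Matrix.vecMulVec_apply, k]
      by_cases hi : i = s
      · subst hi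
        simp only [Pi.single_eq_same]
        ring
      · have hP : Pmat T w i j = Pmat T u i j := by simp [Pmat, huw i hi]
        simp only [hP, Pi.single_eq_of_ne hi]
        ring
    rw [hrow, Matrix.add_mulVec, Matrix.smul_mulVec, Matrix.vecMulVec_mulVec]
    ext i
    simp [mul_comm, mul_left_comm]
  have hrt : ∀ t, rvec R (policySegment u w t) = rvec R u + (t * ρ) • Pi.single s 1 := by
    intro t
    ext i
    simp only [rvec_policySegment, Pi.add_apply, Pi.smul_apply, smul_eq_mul, ρ]
    by_cases hi : i = s
    · subst hi
      simp only [Pi.single_eq_same]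
      ring
    · have hr : rvec R w i = rvec R u i := by simp [rvec, huw i hi]
      simp only [hr, Pi.single_eq_of_ne hi]
      ring
  let z : S → ℝ := (M 0)⁻¹ *ᵥ Pi.single s 1
  have hz : M 0 *ᵥ z = Pi.single s 1 := by
    simp only [z, Matrix.mulVec_mulVec, Matrix.mul_nonsing_inv _ hdet0, Matrix.one_mulVec]
  have hz0 : z ≠ 0 := by
    intro h
    rw [h, Matrix.mulVec_zero] at hz
    have := congrFun hz s
    simp at this
  let κ : ℝ := k ⬝ᵥ z
  have hne : ∀ t, 0 ≤ t → t ≤ 1 → 1 + t * κ ≠ 0 := by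
    intro t ht0 ht1 h
    apply hz0
    apply Matrix.eq_zero_of_mulVec_eq_zero (hdet t ht0 ht1).ne_zero
    rw [hMt, hz]
    have : (Pi.single s 1 : S → ℝ) + (t * (k ⬝ᵥ z)) • Pi.single s 1
        = (1 + t * κ) • Pi.single s 1 := by rw [add_smul, one_smul]
    rw [this, h, zero_smul]
  have hpos : ∀ t, 0 ≤ t → t ≤ 1 → 0 < 1 + t * κ := by
    intro t ht0 ht1
    by_contra hcon
    have hκ : κ ≤ -1 := by
      by_contra hκ
      push Not at hκ hcon
      nlinarith [mul_nonneg ht0 (sub_pos.2 hκ).le]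
    have hκ0 : κ < 0 := by linarith
    refine hne (-κ⁻¹) ?_ ?_ ?_
    · have := inv_lt_zero.2 hκ0
      linarith
    · rw [← inv_neg]
      exact inv_le_one_of_one_le₀ (by linarith)
    · rw [neg_mul, inv_mul_cancel₀ hκ0.ne, add_neg_cancel]
  let V : ℝ → S → ℝ := fun t => (M t)⁻¹ *ᵥ rvec R (policySegment u w t)
  have hMV : ∀ t, 0 ≤ t → t ≤ 1 → M t *ᵥ V t = rvec R (policySegment u w t) := by
    intro t ht0 ht1
    simp only [V, Matrix.mulVec_mulVec, Matrix.mul_nonsing_inv _ (hdet t ht0 ht1),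
      Matrix.one_mulVec]
  have hV : ∀ t, 0 ≤ t → t ≤ 1 → V t = V 0 + (t * (ρ - k ⬝ᵥ V t)) • z := by
    intro t ht0 ht1
    have h1 := hMV t ht0 ht1
    have h0 := hMV 0 le_rfl zero_le_one
    rw [policySegment_zero] at h0
    rw [hMt, hrt] at h1
    rw [← sub_eq_zero]
    apply Matrix.eq_zero_of_mulVec_eq_zero hdet0.ne_zero
    rw [Matrix.mulVec_sub, Matrix.mulVec_add, Matrix.mulVec_smul, hz, h0,
      eq_sub_of_add_eq h1]
    module
  refine ⟨(ρ - k ⬝ᵥ V 0) * (d0 ⬝ᵥ z), κ, fun t ht0 ht1 => ⟨hpos t ht0 ht1, ?_⟩⟩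
  have hJ : ∀ t, Jval T R d0 γ (policySegment u w t) = d0 ⬝ᵥ V t := fun t => rfl
  have hJ0 : Jval T R d0 γ u = d0 ⬝ᵥ V 0 := by
    rw [← hJ, policySegment_zero]
  have hkV : (1 + t * κ) * (ρ - k ⬝ᵥ V t) = ρ - k ⬝ᵥ V 0 := by
    have := congrArg (fun v => k ⬝ᵥ v) (hV t ht0 ht1)
    simp only [dotProduct_add, dotProduct_smul, smul_eq_mul] at this
    change k ⬝ᵥ V t = k ⬝ᵥ V 0 + t * (ρ - k ⬝ᵥ V t) * κ at this
    linear_combination -this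
  have hJt := congrArg (fun v => d0 ⬝ᵥ v) (hV t ht0 ht1)
  simp only [dotProduct_add, dotProduct_smul, smul_eq_mul] at hJt
  rw [hJ, hJ0, hJt, ← hkV]
  have := (hpos t ht0 ht1).ne'
  field_simp

/-- A function of policies that is unchanged by modifying a policy in one state, as long as the
local policies stay in a set `K`, is constant on the policies with values in `K`. -/
lemma eq_of_forall_update_eq {B : Type*} (K : Set B) (f : (S → B) → ℝ)
    (h : ∀ u : S → B, (∀ i, u i ∈ K) → ∀ s, ∀ q ∈ K, f (Function.update u s q) = f u)
    {u w : S → B} (hu : ∀ i, u i ∈ K) (hw : ∀ i, w i ∈ K) : f w = f u := by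
  have key : ∀ I : Finset S, f (I.piecewise w u) = f u := by
    intro I
    induction I using Finset.induction_on with
    | empty => simp
    | insert j I _ ih =>
      rw [Finset.piecewise_insert, h _ _ j (w j) (hw j), ih]
      intro i
      by_cases hi : i ∈ I <;> simp [hi, hu, hw]
  simpa using key Finset.univ

/-- A value function that is non-constant on policies is non-constant on the `δ`-deterministic
policies favouring a fixed action, already between two policies that differ in one state. -/
lemma exists_Jval_lt_of_differ_at_one_state {T : S → A → S → ℝ} (hT : IsTransModel T)
    (R : S → A → ℝ) (d0 : S → ℝ) {γ : ℝ} (hγ0 : 0 ≤ γ) (hγ1 : γ < 1) {δ : ℝ} (hδ : δ < 1)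
    (a₀ : A) {π π' : S → A → ℝ} (hπ : IsPolicy π) (hπ' : IsPolicy π')
    (hne : Jval T R d0 γ π ≠ Jval T R d0 γ π') :
    ∃ u w : S → A → ℝ, IsPolicy u ∧ IsPolicy w ∧ (∀ s, δ < u s a₀) ∧ (∀ s, δ < w s a₀) ∧
      (∃ s, ∀ i, i ≠ s → w i = u i) ∧ Jval T R d0 γ u < Jval T R d0 γ w := by
  classical
  let K : Set (A → ℝ) := {q | ((∀ a, 0 ≤ q a) ∧ ∑ a, q a = 1) ∧ δ < q a₀}
  by_contra hcon
  push Not at hcon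
  have hupd : ∀ u : S → A → ℝ, (∀ i, u i ∈ K) → ∀ s, ∀ q ∈ K,
      Jval T R d0 γ (Function.update u s q) = Jval T R d0 γ u := by
    intro u hu s q hq
    have hw : ∀ i, Function.update u s q i ∈ K := by
      intro i
      by_cases hi : i = s
      · subst hi; simpa using hq
      · simpa [hi] using hu i
    refine le_antisymm ?_ ?_
    · exact hcon u _ (fun i => (hu i).1) (fun i => (hw i).1) (fun i => (hu i).2)
        (fun i => (hw i).2) ⟨s, fun i hi => Function.update_of_ne hi _ _⟩
    · exact hcon _ u (fun i => (hw i).1) (fun i => (hu i).1) (fun i => (hw i).2)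
        (fun i => (hu i).2) ⟨s, fun i hi => (Function.update_of_ne hi _ _).symm⟩
  let y : S → A → ℝ := fun _ => Pi.single a₀ 1
  have hy : IsPolicy y := by
    refine fun s => ⟨fun a => ?_, by simp [y]⟩
    by_cases ha : a = a₀
    · subst ha; simp [y]
    · simp [y, ha]
  have hyK : ∀ i, y i ∈ K := fun i => ⟨hy i, by simpa [y] using hδ⟩
  have hconst : ∀ x, IsPolicy x → Jval T R d0 γ x = Jval T R d0 γ y := by
    intro x hx
    have hrel := bilinear_relation_of_eventually hT hT R d0 hγ0 hγ1 hy hx 0 1 0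
      (-Jval T R d0 γ y) ?_
    · linarith
    have hlt : ∀ᶠ t in nhdsWithin (0 : ℝ) (Set.Ioi 0), t < 1 - δ ∧ t < 1 :=
      nhdsWithin_le_nhds (Filter.inter_mem (Iio_mem_nhds (sub_pos.2 hδ)) (Iio_mem_nhds one_pos))
    filter_upwards [hlt, self_mem_nhdsWithin] with t ht ht0
    have ht0' : 0 < t := ht0
    have hmem : ∀ i, policySegment y x t i ∈ K := by
      refine fun i => ⟨hy.policySegment hx ht0'.le ht.2.le i, ?_⟩
      have := mul_nonneg ht0'.le ((hx i).1 a₀)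
      simp only [policySegment, y, Pi.single_eq_same]
      linarith [ht.1]
    rw [eq_of_forall_update_eq K (Jval T R d0 γ) hupd hyK hmem]
    ring
  exact hne ((hconst π hπ).trans (hconst π' hπ').symm)

/-- Without exploitability, the two value functions are related by an invertible
linear-fractional map on all policies. -/
lemma exists_linearFractional_relation {T T' : S → A → S → ℝ} (hT : IsTransModel T)
    (hT' : IsTransModel T') (R : S → A → ℝ) (d0 : S → ℝ) {γ : ℝ} (hγ0 : 0 ≤ γ) (hγ1 : γ < 1)
    {δ : ℝ} (hδ : δ < 1) (a₀ : A)
    (hnc : ∃ π ∈ DeltaDet (S := S) (A := A) δ, ∃ π' ∈ DeltaDet δ,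
      Jval T R d0 γ π ≠ Jval T R d0 γ π')
    (hnc' : ∃ π ∈ DeltaDet (S := S) (A := A) δ, ∃ π' ∈ DeltaDet δ,
      Jval T' R d0 γ π ≠ Jval T' R d0 γ π')
    (hno : ∀ π ∈ DeltaDet (S := S) (A := A) δ, ∀ π' ∈ DeltaDet δ,
      Jval T R d0 γ π' < Jval T R d0 γ π → Jval T' R d0 γ π' ≤ Jval T' R d0 γ π) :
    ∃ c c' m m' l : ℝ, m ≠ 0 ∧ m' ≠ 0 ∧ ∀ x : S → A → ℝ, IsPolicy x →
      (Jval T' R d0 γ x - c') * (m + l * (Jval T R d0 γ x - c)) =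
        m' * (Jval T R d0 γ x - c) := by
  obtain ⟨π, hπ, π', hπ', hne⟩ := hnc
  obtain ⟨u, w, hu, hw, huδ, hwδ, ⟨s, huw⟩, hlt⟩ :=
    exists_Jval_lt_of_differ_at_one_state hT R d0 hγ0 hγ1 hδ a₀ hπ.1 hπ'.1 hne
  obtain ⟨m, κ, hφ⟩ :=
    exists_Jval_policySegment_eq_linearFractional hT R d0 hγ0 hγ1 hu hw s huw
  obtain ⟨m', κ', hψ⟩ :=
    exists_Jval_policySegment_eq_linearFractional hT' R d0 hγ0 hγ1 hu hw s huw
  set c := Jval T R d0 γ u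
  set c' := Jval T' R d0 γ u
  have hm : 0 < m := by
    have h1 := hφ 1 zero_le_one le_rfl
    rw [policySegment_one, one_mul, one_mul] at h1
    have h2 : 0 < m / (1 + κ) := by linarith [h1.2]
    exact (div_pos_iff_of_pos_right h1.1).1 h2
  have hmono : ∀ t t', 0 ≤ t → t < t' → t' ≤ 1 →
      Jval T R d0 γ (policySegment u w t) < Jval T R d0 γ (policySegment u w t') := by
    intro t t' ht htt ht'
    obtain ⟨hp, he⟩ := hφ t ht (by linarith)
    obtain ⟨hp', he'⟩ := hφ t' (by linarith) ht'
    rw [he, he', add_lt_add_iff_left, div_lt_div_iff₀ hp hp']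
    nlinarith
  have hmemδ : ∀ t, 0 ≤ t → t ≤ 1 → ∀ i, δ < policySegment u w t i a₀ := by
    intro t ht0 ht1 i
    have h1 := huδ i
    have h2 := hwδ i
    simp only [policySegment]
    rcases ht0.eq_or_lt with rfl | ht
    · simpa using h1
    · nlinarith [mul_pos ht (sub_pos.2 h2), mul_nonneg (sub_nonneg.2 ht1) (sub_pos.2 h1).le]
  have hmem : ∀ t, 0 ≤ t → t ≤ 1 → policySegment u w t ∈ DeltaDet δ := fun t ht0 ht1 =>
    ⟨hu.policySegment hw ht0 ht1, fun i => ⟨a₀, (hmemδ t ht0 ht1 i).le⟩⟩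
  have hcont : ContinuousOn (fun t => Jval T R d0 γ (policySegment u w t)) (Set.Icc 0 1) := by
    have : ContinuousOn (fun t : ℝ => c + t * m / (1 + t * κ)) (Set.Icc 0 1) :=
      continuousOn_const.add (ContinuousOn.div (by fun_prop) (by fun_prop)
        fun t ht => (hφ t ht.1 ht.2).1.ne')
    exact this.congr fun t ht => (hφ t ht.1 ht.2).2
  -- Near the segment, the second value is determined by the first one.
  have hlocal : ∀ x ∈ DeltaDet (S := S) (A := A) δ, c < Jval T R d0 γ x →
      Jval T R d0 γ x < Jval T R d0 γ w → ∃ t, 0 < t ∧ t < 1 ∧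
        Jval T R d0 γ x = Jval T R d0 γ (policySegment u w t) ∧
        Jval T' R d0 γ x = Jval T' R d0 γ (policySegment u w t) := by
    intro x hx hcx hxw
    have hivt := intermediate_value_Ioo zero_le_one hcont
    simp only [policySegment_zero, policySegment_one] at hivt
    obtain ⟨t, ⟨ht0, ht1⟩, hft⟩ := hivt ⟨hcx, hxw⟩
    simp only at hft
    refine ⟨t, ht0, ht1, hft.symm, ?_⟩
    have hψc : ContinuousAt (fun t : ℝ => c' + t * m' / (1 + t * κ')) t :=
      continuousAt_const.add (ContinuousAt.div (by fun_prop) (by fun_prop)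
        (hψ t ht0.le ht1.le).1.ne')
    rw [(hψ t ht0.le ht1.le).2]
    apply le_antisymm
    · refine ge_of_tendsto (hψc.tendsto.mono_left (nhdsWithin_le_nhds (s := Set.Ioi t))) ?_
      filter_upwards [Ioo_mem_nhdsGT ht1] with t' ht'
      rw [← (hψ t' (ht0.trans ht'.1).le ht'.2.le).2]
      refine hno _ (hmem t' (ht0.trans ht'.1).le ht'.2.le) x hx ?_
      rw [← hft]
      exact hmono t t' ht0.le ht'.1 ht'.2.le
    · refine le_of_tendsto (hψc.tendsto.mono_left (nhdsWithin_le_nhds (s := Set.Iio t))) ?_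
      filter_upwards [Ioo_mem_nhdsLT ht0] with t' ht'
      rw [← (hψ t' ht'.1.le (ht'.2.trans ht1).le).2]
      refine hno x hx _ (hmem t' ht'.1.le (ht'.2.trans ht1).le) ?_
      rw [← hft]
      exact hmono t' t ht'.1.le ht'.2 ht1.le
  let y := policySegment u w (1 / 2)
  have hy : IsPolicy y := hu.policySegment hw (by norm_num) (by norm_num)
  have hyδ : ∀ i, δ < y i a₀ := hmemδ _ (by norm_num) (by norm_num)
  have hcy : c < Jval T R d0 γ y := by
    have := hmono 0 (1 / 2) le_rfl (by norm_num) (by norm_num)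
    rwa [policySegment_zero] at this
  have hyw : Jval T R d0 γ y < Jval T R d0 γ w := by
    have := hmono (1 / 2) 1 (by norm_num) (by norm_num) le_rfl
    rwa [policySegment_one] at this
  have hnear : ∀ x, IsPolicy x → ∀ᶠ τ in nhdsWithin (0 : ℝ) (Set.Ioi 0), ∃ t, 0 < t ∧ t < 1 ∧
      Jval T R d0 γ (policySegment y x τ) = c + t * m / (1 + t * κ) ∧
      Jval T' R d0 γ (policySegment y x τ) = c' + t * m' / (1 + t * κ') := by
    intro x hx
    have hlim := tendsto_Jval_policySegment hT R d0 hγ0 hγ1 hy hx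
    filter_upwards [eventually_policySegment_mem_DeltaDet a₀ hy hyδ hx,
      nhdsWithin_le_nhds (hlim (Ioo_mem_nhds hcy hyw))] with τ hτ hτ'
    obtain ⟨t, ht0, ht1, h1, h2⟩ := hlocal _ hτ hτ'.1 hτ'.2
    exact ⟨t, ht0, ht1, h1.trans (hφ t ht0.le ht1.le).2, h2.trans (hψ t ht0.le ht1.le).2⟩
  have hm' : m' ≠ 0 := by
    intro h0
    have hconst : ∀ x, IsPolicy x → Jval T' R d0 γ x = c' := by
      intro x hx
      have hrel := bilinear_relation_of_eventually hT hT' R d0 hγ0 hγ1 hy hx 0 0 1 (-c') ?_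
      · linarith
      filter_upwards [hnear x hx] with τ ⟨t, _, _, _, h2⟩
      rw [h2, h0]
      ring
    obtain ⟨σ, hσ, σ', hσ', hne'⟩ := hnc'
    exact hne' ((hconst σ hσ.1).trans (hconst σ' hσ'.1).symm)
  refine ⟨c, c', m, m', κ' - κ, hm.ne', hm', fun x hx => ?_⟩
  have hrel := bilinear_relation_of_eventually hT hT' R d0 hγ0 hγ1 hy hx (κ' - κ)
    (-c' * (κ' - κ) - m') (m - (κ' - κ) * c) (-c' * (m - (κ' - κ) * c) + m' * c) ?_
  · linear_combination hrel
  filter_upwards [hnear x hx] with τ ⟨t, ht0, ht1, h1, h2⟩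
  have hp := (hφ t ht0.le ht1.le).1.ne'
  have hp' := (hψ t ht0.le ht1.le).1.ne'
  have hF := div_mul_cancel₀ (t * m) hp
  have hG := div_mul_cancel₀ (t * m') hp'
  rw [h1, h2]
  generalize t * m / (1 + t * κ) = p at hF
  generalize t * m' / (1 + t * κ') = q at hG
  apply mul_left_cancel₀ ht0.ne'
  linear_combination p * hG - q * hF

end Value

/-- **Exploitability on δ-deterministic policies** (`δ < 1`): every
non-trivial, non-equivalent pair of transition models is exploitable on
`Π_δ`. -/
theorem stmt11 {S A : Type*} [Fintype S] [Fintype A] [DecidableEq S] [Nonempty S]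
    (hA : 1 < Fintype.card A)
    (d0 : S → ℝ) (hd0 : IsDist d0) (R : S → A → ℝ)
    (γ : ℝ) (hγ0 : 0 ≤ γ) (hγ1 : γ < 1)
    (δ : ℝ) (hδ : δ < 1)
    (T T' : S → A → S → ℝ) (hT : IsTransModel T) (hT' : IsTransModel T')
    -- `J_T` is non-constant on `Π_δ`
    (hnc : ∃ π ∈ DeltaDet (S := S) (A := A) δ, ∃ π' ∈ DeltaDet δ,
      Jval T R d0 γ π ≠ Jval T R d0 γ π')
    -- `J_{T'}` is non-constant on `Π_δ`
    (hnc' : ∃ π ∈ DeltaDet (S := S) (A := A) δ, ∃ π' ∈ DeltaDet δ,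
      Jval T' R d0 γ π ≠ Jval T' R d0 γ π')
    -- `J_T` and `J_{T'}` do not induce the same ordering on `Π_δ`
    (hneq : ¬ ∀ π ∈ DeltaDet (S := S) (A := A) δ, ∀ π' ∈ DeltaDet δ,
      (Jval T R d0 γ π' ≤ Jval T R d0 γ π ↔
        Jval T' R d0 γ π' ≤ Jval T' R d0 γ π)) :
    ∃ π ∈ DeltaDet (S := S) (A := A) δ, ∃ π' ∈ DeltaDet δ,
      Jval T R d0 γ π' < Jval T R d0 γ π ∧
      Jval T' R d0 γ π < Jval T' R d0 γ π' := by
  obtain ⟨a₀⟩ : Nonempty A := Fintype.card_pos_iff.1 (by omega)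
  by_contra hcon
  push Not at hcon
  obtain ⟨c, c', m, m', l, hm, hm', hrel⟩ :=
    exists_linearFractional_relation hT hT' R d0 hγ0 hγ1 hδ a₀ hnc hnc' hcon
  apply hneq
  intro π hπ π' hπ'
  have h1 := hrel π hπ.1
  have h2 := hrel π' hπ'.1
  constructor
  · intro hle
    rcases hle.eq_or_lt with heq | hlt
    · rw [heq] at h2
      have hne : m + l * (Jval T R d0 γ π - c) ≠ 0 := by
        intro h0
        rw [h0, mul_zero] at h1
        have hF := (mul_eq_zero.1 h1.symm).resolve_left hm'
        rw [hF, mul_zero, add_zero] at h0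
        exact hm h0
      have := mul_right_cancel₀ hne (h2.trans h1.symm)
      linarith
    · exact hcon π hπ π' hπ' hlt
  · intro hle
    by_contra hlt
    push Not at hlt
    have heq := le_antisymm (hcon π' hπ' π hπ hlt) hle
    rw [← heq] at h2
    have hne : m' - l * (Jval T' R d0 γ π - c') ≠ 0 := by
      intro h0
      have hG : (Jval T' R d0 γ π - c') * m = 0 := by
        linear_combination h1 + (Jval T R d0 γ π - c) * h0
      rw [(mul_eq_zero.1 hG).resolve_right hm, mul_zero, sub_zero] at h0
      exact hm' h0
    have : Jval T R d0 γ π = Jval T R d0 γ π' := by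
      apply mul_left_cancel₀ hne
      linear_combination h2 - h1
    linarith
end

section
/- Safe horizon theorem (guarantee part): fix a finite task (S, A, d0, R, γ) with R : S × A → [0,1] and γ ∈ [0,1), and let T, T' be distinct transition models with total variation distance δ = (1/2) max_{s,a} ‖T(·|s,a) − T'(·|s,a)‖_1 > 0. For ε > 0, define H(ε, δ) = ((1+ε) + √((1−ε)² + 4ε/δ)) / 2. If 1/(1−γ) ≤ H(ε, δ), then (T, T') is ε-unexploitable on every set Π of stationary policies: there exist no π, π' with J_T(π) − J_T(π') > ε and J_{T'}(π') − J_{T'}(π) > ε. -/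
open Matrix

/-- The matrix `P` is row-stochastic. -/
def IsStochastic {S : Type*} [Fintype S] (P : Matrix S S ℝ) : Prop :=
  ∀ s, IsDist (P s)

theorem isStochastic_Pmat {S A : Type*} [Fintype S] [Fintype A] {T : S → A → S → ℝ}
    {π : S → A → ℝ} (hT : IsTransModel T) (hπ : IsPolicy π) : IsStochastic (Pmat T π) := by
  refine fun s => ⟨fun s' => ?_, ?_⟩
  · exact Finset.sum_nonneg fun a _ => mul_nonneg ((hπ s).1 a) ((hT s a).1 s')
  · simp only [Pmat, Matrix.of_apply]
    rw [Finset.sum_comm]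
    simp only [← Finset.mul_sum, (hT s _).2, mul_one, (hπ s).2]

theorem rvec_mem_Icc {S A : Type*} [Fintype A] {R : S → A → ℝ} {π : S → A → ℝ}
    (hR : ∀ s a, R s a ∈ Set.Icc (0 : ℝ) 1) (hπ : IsPolicy π) (s : S) :
    rvec R π s ∈ Set.Icc (0 : ℝ) 1 := by
  refine ⟨Finset.sum_nonneg fun a _ => mul_nonneg ((hπ s).1 a) (hR s a).1, ?_⟩
  rw [← (hπ s).2]
  exact Finset.sum_le_sum fun a _ => mul_le_of_le_one_right ((hπ s).1 a) (hR s a).2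

theorem sum_abs_Pmat_sub_le {S A : Type*} [Fintype S] [Fintype A] {T T' : S → A → S → ℝ}
    {π : S → A → ℝ} {c : ℝ} (hπ : IsPolicy π)
    (hc : ∀ s a, ∑ s', |T s a s' - T' s a s'| ≤ c) (s : S) :
    ∑ s', |Pmat T π s s' - Pmat T' π s s'| ≤ c := by
  calc ∑ s', |Pmat T π s s' - Pmat T' π s s'|
      ≤ ∑ s', ∑ a, π s a * |T s a s' - T' s a s'| := by
        refine Finset.sum_le_sum fun s' _ => ?_
        simp only [Pmat, Matrix.of_apply, ← Finset.sum_sub_distrib, ← mul_sub]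
        refine (Finset.abs_sum_le_sum_abs _ _).trans_eq (Finset.sum_congr rfl fun a _ => ?_)
        rw [abs_mul, abs_of_nonneg ((hπ s).1 a)]
    _ = ∑ a, π s a * ∑ s', |T s a s' - T' s a s'| := by
        rw [Finset.sum_comm]
        simp only [Finset.mul_sum]
    _ ≤ ∑ a, π s a * c :=
        Finset.sum_le_sum fun a _ => mul_le_mul_of_nonneg_left (hc s a) ((hπ s).1 a)
    _ = c := by rw [← Finset.sum_mul, (hπ s).2, one_mul]

theorem sum_mul_le_of_isDist {S : Type*} [Fintype S] {p v : S → ℝ} {c : ℝ} (hp : IsDist p)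
    (hv : ∀ s, v s ≤ c) : ∑ s, p s * v s ≤ c := by
  calc ∑ s, p s * v s ≤ ∑ s, p s * c :=
        Finset.sum_le_sum fun s _ => mul_le_mul_of_nonneg_left (hv s) (hp.1 s)
    _ = c := by rw [← Finset.sum_mul, hp.2, one_mul]

theorem le_sum_mul_of_isDist {S : Type*} [Fintype S] {p v : S → ℝ} {c : ℝ} (hp : IsDist p)
    (hv : ∀ s, c ≤ v s) : c ≤ ∑ s, p s * v s := by
  have h := sum_mul_le_of_isDist (v := fun s => -v s) (c := -c) hp fun s => neg_le_neg (hv s)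
  simp only [mul_neg, Finset.sum_neg_distrib] at h
  linarith

/-- The discounted resolvent of a stochastic matrix solves the Bellman equation. -/
theorem bellman_equation {S : Type*} [Fintype S] [DecidableEq S] {P : Matrix S S ℝ} {γ : ℝ}
    (hγ0 : 0 ≤ γ) (hγ1 : γ < 1) (hP : IsStochastic P) (r : S → ℝ) (s : S) :
    ((1 - γ • P)⁻¹ *ᵥ r) s = r s + γ * ∑ s', P s s' * ((1 - γ • P)⁻¹ *ᵥ r) s' := by
  have hdet : (1 - γ • P).det ≠ 0 := by
    refine det_ne_zero_of_sum_row_lt_diag fun k => ?_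
    have hoff : ∑ j ∈ Finset.univ.erase k, ‖(1 - γ • P) k j‖
        = ∑ j ∈ Finset.univ.erase k, γ * P k j := by
      refine Finset.sum_congr rfl fun j hj => ?_
      rw [Matrix.sub_apply, Matrix.one_apply_ne (Finset.ne_of_mem_erase hj).symm, zero_sub,
        norm_neg, Matrix.smul_apply, smul_eq_mul, Real.norm_eq_abs,
        abs_of_nonneg (mul_nonneg hγ0 ((hP k).1 j))]
    have hsum := Finset.add_sum_erase Finset.univ (P k) (Finset.mem_univ k)
    rw [(hP k).2] at hsum
    rw [hoff, ← Finset.mul_sum, Matrix.sub_apply, Matrix.one_apply_eq, Matrix.smul_apply,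
      smul_eq_mul]
    refine lt_of_lt_of_le ?_ (le_abs_self _)
    linear_combination hγ1 + γ * hsum
  have h := congrFun (Matrix.mulVec_mulVec r (1 - γ • P) (1 - γ • P)⁻¹) s
  rw [Matrix.mul_nonsing_inv _ (isUnit_iff_ne_zero.mpr hdet), Matrix.one_mulVec,
    Matrix.sub_mulVec, Matrix.one_mulVec, Matrix.smul_mulVec] at h
  simp only [Pi.sub_apply, Pi.smul_apply, smul_eq_mul] at h
  rw [← h]
  simp [Matrix.mulVec, dotProduct]

theorem bellman_mem_Icc {S : Type*} [Fintype S] [Nonempty S] {P : Matrix S S ℝ} {γ : ℝ}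
    (hγ0 : 0 ≤ γ) (hγ1 : γ < 1) (hP : IsStochastic P) {r v : S → ℝ}
    (hr : ∀ s, r s ∈ Set.Icc (0 : ℝ) 1) (hv : ∀ s, v s = r s + γ * ∑ s', P s s' * v s') (s : S) :
    v s ∈ Set.Icc (0 : ℝ) (1 / (1 - γ)) := by
  obtain ⟨i, hi⟩ := Finite.exists_min v
  obtain ⟨j, hj⟩ := Finite.exists_max v
  have hγ : 0 < 1 - γ := sub_pos.mpr hγ1
  constructor
  · refine le_trans ?_ (hi s)
    have := mul_le_mul_of_nonneg_left (le_sum_mul_of_isDist (hP i) hi) hγ0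
    have := hv i
    have := (hr i).1
    by_contra! hneg
    nlinarith
  · refine (hj s).trans ?_
    rw [le_div_iff₀ hγ]
    have := mul_le_mul_of_nonneg_left (sum_mul_le_of_isDist (hP j) hj) hγ0
    have := hv j
    have := (hr j).2
    linarith

/-- Maximal coupling bound: two distributions at total variation distance at most `δ`, applied to
`D`-close functions with values in `[0, h]`, have means that differ by at most
`(1 - δ) D + δ h`. -/
theorem sum_mul_sub_sum_mul_le {S : Type*} [Fintype S] {p q v w : S → ℝ} {δ D h : ℝ}
    (hp : IsDist p) (hq : IsDist q) (hpq : ∑ s, |p s - q s| ≤ 2 * δ)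
    (hv : ∀ s, v s ≤ h) (hw : ∀ s, 0 ≤ w s) (hvw : ∀ s, v s - w s ≤ D) (hDh : D ≤ h) :
    ∑ s, p s * v s - ∑ s, q s * w s ≤ (1 - δ) * D + δ * h := by
  have hterm : ∀ s, p s * v s - q s * w s
      ≤ (p s + q s - |p s - q s|) / 2 * D + (p s - q s + |p s - q s|) / 2 * h := by
    intro s
    rcases le_total (p s) (q s) with hle | hle
    · rw [abs_of_nonpos (sub_nonpos.mpr hle)]
      have := mul_nonneg (hp.1 s) (sub_nonneg.mpr (hvw s))
      have := mul_nonneg (sub_nonneg.mpr hle) (hw s)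
      linarith
    · rw [abs_of_nonneg (sub_nonneg.mpr hle)]
      have := mul_nonneg (hq.1 s) (sub_nonneg.mpr (hvw s))
      have := mul_nonneg (sub_nonneg.mpr hle) (sub_nonneg.mpr (hv s))
      linarith
  have hsum := Finset.sum_le_sum fun s (_ : s ∈ Finset.univ) => hterm s
  rw [Finset.sum_sub_distrib, Finset.sum_add_distrib, ← Finset.sum_mul, ← Finset.sum_mul,
    ← Finset.sum_div, ← Finset.sum_div, Finset.sum_sub_distrib, Finset.sum_add_distrib,
    Finset.sum_add_distrib, Finset.sum_sub_distrib, hp.2, hq.2] at hsum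
  have := mul_nonneg (sub_nonneg.mpr hpq) (sub_nonneg.mpr hDh)
  linarith

/-- Simulation lemma: solutions of the Bellman equations of two stochastic matrices at row-wise
total variation distance at most `δ` are uniformly close. -/
theorem exists_bellman_abs_sub_le {S : Type*} [Fintype S] [Nonempty S] {P Q : Matrix S S ℝ}
    {γ δ : ℝ} (hγ0 : 0 ≤ γ) (hγ1 : γ < 1) (hP : IsStochastic P) (hQ : IsStochastic Q)
    (hPQ : ∀ s, ∑ s', |P s s' - Q s s'| ≤ 2 * δ) {r v w : S → ℝ}
    (hr : ∀ s, r s ∈ Set.Icc (0 : ℝ) 1) (hv : ∀ s, v s = r s + γ * ∑ s', P s s' * v s')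
    (hw : ∀ s, w s = r s + γ * ∑ s', Q s s' * w s') :
    ∃ D : ℝ, (∀ s, |v s - w s| ≤ D) ∧ D ≤ 1 / (1 - γ) ∧
      D ≤ γ * ((1 - δ) * D + δ * (1 / (1 - γ))) := by
  obtain ⟨i, hi⟩ := Finite.exists_max fun s => |v s - w s|
  have hvI := bellman_mem_Icc hγ0 hγ1 hP hr hv
  have hwI := bellman_mem_Icc hγ0 hγ1 hQ hr hw
  have hDh : |v i - w i| ≤ 1 / (1 - γ) := by
    have := hvI i
    have := hwI i
    simp only [Set.mem_Icc] at *
    rw [abs_le]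
    constructor <;> linarith
  refine ⟨|v i - w i|, hi, hDh, ?_⟩
  have hvw := sum_mul_sub_sum_mul_le (hP i) (hQ i) (hPQ i) (fun s => (hvI s).2)
    (fun s => (hwI s).1) (fun s => (le_abs_self _).trans (hi s)) hDh
  have hwv := sum_mul_sub_sum_mul_le (hQ i) (hP i)
    (by simpa only [abs_sub_comm] using hPQ i) (fun s => (hwI s).2) (fun s => (hvI s).1)
    (fun s => (neg_sub (v s) (w s) ▸ neg_le_abs _).trans (hi s)) hDh
  have hvw' := mul_le_mul_of_nonneg_left hvw hγ0
  have hwv' := mul_le_mul_of_nonneg_left hwv hγ0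
  have hvi := hv i
  have hwi := hw i
  refine abs_le.mpr ⟨?_, ?_⟩ <;> linarith

/-- Within the safe horizon, the simulation error is at most `ε`. -/
theorem le_of_safe_horizon {γ δ ε D : ℝ} (hγ0 : 0 ≤ γ) (hγ1 : γ < 1) (hδ : 0 < δ)
    (hε : 0 < ε)
    (hH : 1 / (1 - γ) ≤ ((1 + ε) + Real.sqrt ((1 - ε) ^ 2 + 4 * ε / δ)) / 2)
    (hDh : D ≤ 1 / (1 - γ)) (hD : D ≤ γ * ((1 - δ) * D + δ * (1 / (1 - γ)))) : D ≤ ε := by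
  have hγ : 0 < 1 - γ := sub_pos.mpr hγ1
  have hh : (1 / (1 - γ)) * (1 - γ) = 1 := one_div_mul_cancel hγ.ne'
  set h := 1 / (1 - γ) with h_def
  have hh1 : 1 ≤ h := by
    rw [h_def, le_div_iff₀ hγ]
    linarith
  rcases lt_or_ge (2 * h - (1 + ε)) 0 with hlt | hge
  · linarith
  have hsq : (2 * h - (1 + ε)) ^ 2 ≤ (1 - ε) ^ 2 + 4 * ε / δ := by
    rw [← Real.le_sqrt hge (by positivity)]
    linarith
  have hquad : (h - 1) * (h - ε) ≤ ε / δ := by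
    rw [mul_div_assoc] at hsq
    linarith
  rw [le_div_iff₀ hδ] at hquad
  have hγh : h - 1 = γ * h := by linarith
  rw [hγh] at hquad
  have hDh' : D * (1 + γ * δ * h) ≤ γ * δ * h ^ 2 := by
    have := mul_le_mul_of_nonneg_right hD (zero_le_one.trans hh1)
    linear_combination this - D * hh
  have hpos : 0 < 1 + γ * δ * h := by positivity
  refine le_of_mul_le_mul_right (hDh'.trans ?_) hpos
  linarith

/-- Within the safe horizon, the values of a policy in the two models differ by at most `ε`. -/
theorem abs_Jval_sub_le {S A : Type*} [Fintype S] [Fintype A] [DecidableEq S] [Nonempty S]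
    {d0 : S → ℝ} (hd0 : IsDist d0) {R : S → A → ℝ} (hR : ∀ s a, R s a ∈ Set.Icc (0 : ℝ) 1)
    {γ δ ε : ℝ} (hγ0 : 0 ≤ γ) (hγ1 : γ < 1) {T T' : S → A → S → ℝ} (hT : IsTransModel T)
    (hT' : IsTransModel T') (hTV : ∀ s a, ∑ s', |T s a s' - T' s a s'| ≤ 2 * δ) (hδ : 0 < δ)
    (hε : 0 < ε)
    (hH : 1 / (1 - γ) ≤ ((1 + ε) + Real.sqrt ((1 - ε) ^ 2 + 4 * ε / δ)) / 2)
    {π : S → A → ℝ} (hπ : IsPolicy π) : |Jval T R d0 γ π - Jval T' R d0 γ π| ≤ ε := by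
  have hP := isStochastic_Pmat hT hπ
  have hP' := isStochastic_Pmat hT' hπ
  obtain ⟨D, hD, hDh, hDc⟩ := exists_bellman_abs_sub_le hγ0 hγ1 hP hP'
    (sum_abs_Pmat_sub_le hπ hTV) (rvec_mem_Icc hR hπ)
    (bellman_equation hγ0 hγ1 hP (rvec R π)) (bellman_equation hγ0 hγ1 hP' (rvec R π))
  refine le_trans ?_ (le_of_safe_horizon hγ0 hγ1 hδ hε hH hDh hDc)
  simp only [Jval, ← Finset.sum_sub_distrib, ← mul_sub]
  exact abs_le.mpr ⟨le_sum_mul_of_isDist hd0 fun s => (abs_le.mp (hD s)).1,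
    sum_mul_le_of_isDist hd0 fun s => (abs_le.mp (hD s)).2⟩

/-- **Safe horizon theorem (guarantee part)**: if the effective horizon
`1/(1-γ)` is at most `H(ε,δ) = ((1+ε) + √((1-ε)² + 4ε/δ))/2`, where `δ` is the
total variation distance between the distinct transition models `T` and `T'`,
then `(T, T')` is ε-unexploitable on every set of stationary policies. -/
theorem stmt14 {S A : Type*} [Fintype S] [Fintype A] [DecidableEq S]
    [Nonempty S] [Nonempty A]
    (hA : 1 < Fintype.card A)
    (d0 : S → ℝ) (hd0 : IsDist d0)
    (R : S → A → ℝ) (hR : ∀ s a, R s a ∈ Set.Icc (0 : ℝ) 1)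
    (γ : ℝ) (hγ0 : 0 ≤ γ) (hγ1 : γ < 1)
    (T T' : S → A → S → ℝ) (hT : IsTransModel T) (hT' : IsTransModel T')
    (hTT' : T ≠ T')
    (δ : ℝ)
    -- `δ` is the total variation distance between `T` and `T'`
    (hδdef : δ = (1 / 2) * ⨆ p : S × A, ∑ s', |T p.1 p.2 s' - T' p.1 p.2 s'|)
    (hδpos : 0 < δ)
    (ε : ℝ) (hε : 0 < ε)
    -- the effective horizon is within the safe horizon `H(ε, δ)`
    (hH : 1 / (1 - γ) ≤ ((1 + ε) + Real.sqrt ((1 - ε) ^ 2 + 4 * ε / δ)) / 2) :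
    ∀ Ps : Set (S → A → ℝ), (∀ p ∈ Ps, IsPolicy p) →
      ¬ ∃ π ∈ Ps, ∃ π' ∈ Ps,
        ε < Jval T R d0 γ π - Jval T R d0 γ π' ∧
        ε < Jval T' R d0 γ π' - Jval T' R d0 γ π := by
  rintro Ps hPs ⟨π, hπ, π', hπ', hgap, hgap'⟩
  have hTV : ∀ s a, ∑ s', |T s a s' - T' s a s'| ≤ 2 * δ := by
    intro s a
    have := le_ciSup (Set.finite_range fun p : S × A =>
      ∑ s', |T p.1 p.2 s' - T' p.1 p.2 s'|).bddAbove (s, a)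
    dsimp only at this
    linarith
  have h := abs_le.mp (abs_Jval_sub_le hd0 hR hγ0 hγ1 hT hT' hTV hδpos hε hH (hPs π hπ))
  have h' := abs_le.mp (abs_Jval_sub_le hd0 hR hγ0 hγ1 hT hT' hTV hδpos hε hH (hPs π' hπ'))
  linarith [h.2, h'.1]
end

section
/- Safe horizon tightness: for every δ ∈ (0,1], every ε > 0, and every γ ∈ [0,1) with 1/(1−γ) > H(ε, δ) = ((1+ε) + √((1−ε)² + 4ε/δ)) / 2, there exist a finite task (S, A, d0, R, γ) with R : S × A → [0,1] and transition models T, T' at total variation distance exactly δ such that (T, T') is ε-exploitable: there exist stationary policies π, π' with J_T(π) − J_T(π') > ε and J_{T'}(π') − J_{T'}(π) > ε. (A witness: S = {0,1}, A = {0,1}, d0 concentrated on state 0, R(s,a) = 1{s = 0}, state 1 absorbing under both models; under T, action 0 self-loops at state 0 and action 1 moves to state 1 with probability δ; under T', the roles of the actions are swapped.) -/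
open Matrix

/-- If the induced chain stays in state `0` with probability `p` and is otherwise absorbed in
state `1`, and only state `0` is rewarded, then the value from state `0` is `1 / (1 - γ p)`. -/
lemma Jval_of_absorbing {T : Fin 2 → Fin 2 → Fin 2 → ℝ} {R π : Fin 2 → Fin 2 → ℝ} {γ p : ℝ}
    (hγ0 : 0 ≤ γ) (hγ1 : γ < 1) (hp : p ≤ 1)
    (hP : Pmat T π = !![p, 1 - p; 0, 1]) (hr : rvec R π = ![1, 0]) :
    Jval T R ![1, 0] γ π = 1 / (1 - γ * p) := by
  have hγp : 1 - γ * p ≠ 0 := by nlinarith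
  have hM : (1 : Matrix (Fin 2) (Fin 2) ℝ) - γ • Pmat T π
      = !![1 - γ * p, -(γ * (1 - p)); 0, 1 - γ] := by
    rw [hP]
    ext i j
    fin_cases i <;> fin_cases j <;> simp
  have hdet : IsUnit (!![1 - γ * p, -(γ * (1 - p)); 0, 1 - γ]).det := by
    rw [Matrix.det_fin_two_of, isUnit_iff_ne_zero]
    simpa using ⟨hγp, (sub_pos.2 hγ1).ne'⟩
  have hV : !![1 - γ * p, -(γ * (1 - p)); 0, 1 - γ] *ᵥ ![1 / (1 - γ * p), 0] = ![1, 0] := by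
    ext i
    fin_cases i <;> simp [hγp]
  rw [Jval, hM, hr, ← hV, Matrix.mulVec_mulVec, Matrix.nonsing_inv_mul _ hdet, Matrix.one_mulVec, hV]
  simp

/-- The two-state model in which state `1` is absorbing and state `0` is left only under the
action `b`, with probability `δ`. -/
def leakModel (δ : ℝ) (b : Fin 2) : Fin 2 → Fin 2 → Fin 2 → ℝ :=
  fun s a => if s = 0 then (if a = b then ![1 - δ, δ] else ![1, 0]) else ![0, 1]

/-- The policy that always plays `c`. -/
def constPolicy (c : Fin 2) : Fin 2 → Fin 2 → ℝ :=
  fun _ a => if a = c then 1 else 0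

lemma isPolicy_constPolicy (c : Fin 2) : IsPolicy (constPolicy c) := by
  refine fun _ => ⟨fun a => ?_, by simp [constPolicy]⟩
  unfold constPolicy
  split_ifs <;> norm_num

lemma isTransModel_leakModel {δ : ℝ} (hδ0 : 0 ≤ δ) (hδ1 : δ ≤ 1) (b : Fin 2) :
    IsTransModel (leakModel δ b) := by
  intro s a
  unfold leakModel
  refine ⟨fun s' => ?_, ?_⟩
  · split_ifs <;> fin_cases s' <;> simp [hδ0, hδ1]
  · split_ifs <;> simp

lemma Jval_leakModel {δ γ : ℝ} (hδ0 : 0 ≤ δ) (hγ0 : 0 ≤ γ) (hγ1 : γ < 1) (b c : Fin 2) :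
    Jval (leakModel δ b) (fun s _ => ![1, 0] s) ![1, 0] γ (constPolicy c)
      = 1 / (1 - γ * if c = b then 1 - δ else 1) := by
  apply Jval_of_absorbing hγ0 hγ1
  · split_ifs <;> linarith
  · ext i j
    by_cases h : c = b <;> fin_cases i <;> fin_cases j <;>
      simp [Pmat, constPolicy, leakModel, h]
  · ext i
    simp [rvec, constPolicy]

lemma tvDist_leakModel {δ : ℝ} (hδ0 : 0 ≤ δ) :
    (1 / 2) * (⨆ p : Fin 2 × Fin 2,
      ∑ s', |leakModel δ 1 p.1 p.2 s' - leakModel δ 0 p.1 p.2 s'|) = δ := by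
  have hsum : ∀ p : Fin 2 × Fin 2,
      ∑ s', |leakModel δ 1 p.1 p.2 s' - leakModel δ 0 p.1 p.2 s'|
        = if p.1 = 0 then 2 * δ else 0 := by
    rintro ⟨s, a⟩
    fin_cases s <;> fin_cases a <;> simp [leakModel, abs_of_nonneg hδ0, two_mul]
  have hsup : (⨆ p : Fin 2 × Fin 2, if p.1 = 0 then 2 * δ else 0) = 2 * δ := by
    apply le_antisymm
    · refine ciSup_le fun p => ?_
      split_ifs <;> linarith
    · exact le_ciSup_of_le (Set.finite_range _).bddAbove (0, 0) (by simp)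
  simp_rw [hsum, hsup]
  ring

/-- Beyond the safe horizon, leaking with probability `δ` costs more than `ε`. -/
lemma lt_leak_cost_of_horizon_lt {δ ε γ : ℝ} (hδ0 : 0 < δ) (hγ0 : 0 ≤ γ) (hγ1 : γ < 1)
    (hH : ((1 + ε) + Real.sqrt ((1 - ε) ^ 2 + 4 * ε / δ)) / 2 < 1 / (1 - γ)) :
    ε < 1 / (1 - γ) - 1 / (1 - γ * (1 - δ)) := by
  have hg : 0 < 1 - γ := sub_pos.2 hγ1
  have hleak : 0 < 1 - γ * (1 - δ) := by nlinarith
  have hroot : Real.sqrt ((1 - ε) ^ 2 + 4 * ε / δ) < 2 * (1 / (1 - γ)) - (1 + ε) := by linarith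
  have hpos := (Real.sqrt_nonneg _).trans_lt hroot
  rw [Real.sqrt_lt' hpos] at hroot
  have hquad : ε / δ < (1 / (1 - γ)) ^ 2 - (1 + ε) * (1 / (1 - γ)) + ε := by
    rw [mul_div_assoc] at hroot
    linarith
  have hsimp : (1 / (1 - γ)) ^ 2 - (1 + ε) * (1 / (1 - γ)) + ε
      = (γ - ε * γ * (1 - γ)) / (1 - γ) ^ 2 := by
    field_simp
    ring
  rw [hsimp, div_lt_div_iff₀ hδ0 (by positivity)] at hquad
  rw [div_sub_div _ _ hg.ne' hleak.ne', lt_div_iff₀ (by positivity)]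
  linarith

/-- **Safe horizon tightness**: whenever the effective horizon `1/(1-γ)`
exceeds `H(ε,δ)`, there is a finite task (here with `S = A = Fin 2`) and a pair
of transition models at total variation distance exactly `δ` that is
ε-exploitable on the stationary policies. -/
theorem stmt15 (δ ε γ : ℝ) (hδ0 : 0 < δ) (hδ1 : δ ≤ 1) (hε : 0 < ε)
    (hγ0 : 0 ≤ γ) (hγ1 : γ < 1)
    (hH : ((1 + ε) + Real.sqrt ((1 - ε) ^ 2 + 4 * ε / δ)) / 2 < 1 / (1 - γ)) :
    ∃ (d0 : Fin 2 → ℝ) (R : Fin 2 → Fin 2 → ℝ)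
      (T T' : Fin 2 → Fin 2 → Fin 2 → ℝ),
      IsDist d0 ∧ (∀ s a, R s a ∈ Set.Icc (0 : ℝ) 1) ∧
      IsTransModel T ∧ IsTransModel T' ∧
      -- the total variation distance between `T` and `T'` is exactly `δ`
      (1 / 2) * (⨆ p : Fin 2 × Fin 2, ∑ s', |T p.1 p.2 s' - T' p.1 p.2 s'|) = δ ∧
      -- `(T, T')` is ε-exploitable on the set of stationary policies
      ∃ π π' : Fin 2 → Fin 2 → ℝ, IsPolicy π ∧ IsPolicy π' ∧
        ε < Jval T R d0 γ π - Jval T R d0 γ π' ∧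
        ε < Jval T' R d0 γ π' - Jval T' R d0 γ π := by
  have hcost := lt_leak_cost_of_horizon_lt hδ0 hγ0 hγ1 hH
  refine ⟨![1, 0], fun s _ => ![1, 0] s, leakModel δ 1, leakModel δ 0, ?_, ?_,
    isTransModel_leakModel hδ0.le hδ1 1, isTransModel_leakModel hδ0.le hδ1 0,
    tvDist_leakModel hδ0.le, constPolicy 0, constPolicy 1,
    isPolicy_constPolicy 0, isPolicy_constPolicy 1, ?_, ?_⟩
  · exact ⟨fun s => by fin_cases s <;> simp, by simp⟩
  · intro s _
    fin_cases s <;> simp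
  · simpa [Jval_leakModel hδ0.le hγ0 hγ1] using hcost
  · simpa [Jval_leakModel hδ0.le hγ0 hγ1] using hcost
end

section
/- Corrected Theorem 2 of Skalse et al.: fix a finite environment (S, A, T, d0, γ) with γ ∈ [0,1), and let Π̂ be a finite set of stationary policies whose visit-count vectors {F^π : π ∈ Π̂} are not collinear (do not all lie on a single line in ℝ^{S×A}). Then for any reward function R_1 there exists a reward function R_2 such that J_{R_2} is not constant on Π̂, the pair (R_1, R_2) is unhackable on Π̂ (there exist no π, π' ∈ Π̂ with J_{R_1}(π) > J_{R_1}(π') and J_{R_2}(π') > J_{R_2}(π)), and J_{R_1}, J_{R_2} do not induce the same ordering on Π̂. -/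
open Matrix

/-- Moving from `f` in direction `h` until two values first meet turns every
strict inequality of `f` into a weak one, and some strict inequality into an equality. -/
lemma exists_first_tie {ι : Type*} {X : Set ι} (hX : X.Finite) {f h : ι → ℝ}
    (hpair : ∃ x ∈ X, ∃ y ∈ X, f y < f x ∧ h x < h y) :
    ∃ t : ℝ, 0 < t ∧
      (∀ x ∈ X, ∀ y ∈ X, f y < f x → f y + t * h y ≤ f x + t * h x) ∧
      ∃ x ∈ X, ∃ y ∈ X, f y < f x ∧ f x + t * h x = f y + t * h y := by
  obtain ⟨x₀, hx₀, y₀, hy₀, hxy₀⟩ := hpair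
  have hQ : {p ∈ X ×ˢ X | f p.2 < f p.1 ∧ h p.1 < h p.2}.Finite :=
    (hX.prod hX).subset (Set.sep_subset _ _)
  obtain ⟨⟨x, y⟩, ⟨⟨hx, hy⟩, hf, hh⟩, hmin⟩ := Set.exists_min_image _
    (fun p : ι × ι => (f p.1 - f p.2) / (h p.2 - h p.1)) hQ
    ⟨(x₀, y₀), ⟨hx₀, hy₀⟩, hxy₀⟩
  dsimp only at hx hy hf hh
  have hpos : 0 < (f x - f y) / (h y - h x) := div_pos (sub_pos.2 hf) (sub_pos.2 hh)
  refine ⟨(f x - f y) / (h y - h x), hpos, fun u hu v hv huv => ?_, x, hx, y, hy, hf, ?_⟩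
  · rcases lt_or_ge (h u) (h v) with huv' | huv'
    · have hle := hmin (u, v) ⟨⟨hu, hv⟩, huv, huv'⟩
      have := (le_div_iff₀ (sub_pos.2 huv')).1 hle
      dsimp only at this
      linarith
    · have := mul_le_mul_of_nonneg_left huv' hpos.le
      linarith
  · have := div_mul_cancel₀ (f x - f y) (sub_pos.2 hh).ne'
    linarith

/-- If `h` is not an affine function of `f` on the finite set `X`, then some linear combination
of `f` and `h` is non-constant on `X`, never strictly reverses the order of `f`, and does not
induce the same order as `f`. -/
lemma exists_combination_unhackable {ι : Type*} {X : Set ι} (hX : X.Finite) {f h : ι → ℝ}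
    (hfh : ¬ ∃ a b : ℝ, ∀ x ∈ X, h x = a + f x * b) :
    ∃ a b : ℝ,
      (∃ x ∈ X, ∃ y ∈ X, a * f x + b * h x ≠ a * f y + b * h y) ∧
      (¬ ∃ x ∈ X, ∃ y ∈ X, f y < f x ∧ a * f x + b * h x < a * f y + b * h y) ∧
      ¬ ∀ x ∈ X, ∀ y ∈ X, (f y ≤ f x ↔ a * f y + b * h y ≤ a * f x + b * h x) := by
  obtain ⟨x, hx, y, hy, hxy⟩ : ∃ x ∈ X, ∃ y ∈ X, h x < h y := by
    by_contra! hcon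
    rcases X.eq_empty_or_nonempty with rfl | ⟨z, hz⟩
    · exact hfh ⟨0, 0, by simp⟩
    · exact hfh ⟨h z, 0, fun x hx => by
        rw [mul_zero, add_zero]; exact le_antisymm (hcon z hz x hx) (hcon x hx z hz)⟩
  by_cases hconst : ∀ u ∈ X, ∀ v ∈ X, f u = f v
  · refine ⟨0, 1, ⟨x, hx, y, hy, by simpa using hxy.ne⟩, ?_, fun hall => ?_⟩
    · rintro ⟨u, hu, v, hv, huv, -⟩
      exact huv.ne (hconst v hv u hu)
    · have := (hall x hx y hy).1 (hconst y hy x hx).le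
      linarith
  · obtain ⟨u, hu, v, hv, hf, hne⟩ : ∃ u ∈ X, ∃ v ∈ X, f v < f u ∧ h u ≠ h v := by
      by_contra! hcon
      have heq : ∀ u ∈ X, ∀ v ∈ X, f u ≠ f v → h u = h v := fun u hu v hv huv =>
        huv.lt_or_gt.elim (fun hlt => (hcon v hv u hu hlt).symm) (hcon u hu v hv)
      refine hconst fun u hu v hv => ?_
      have hz : ∀ z ∈ X, f z = f x := fun z hz => by
        by_contra hzx
        have hyx : f y = f x := by
          by_contra hyx
          exact hxy.ne' (heq y hy x hx hyx)
        exact hxy.ne ((heq z hz x hx hzx).symm.trans (heq z hz y hy (hyx ▸ hzx)))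
      rw [hz u hu, hz v hv]
    obtain ⟨b, hb, hmono, p, hp, q, hq, hpq, htie⟩ : ∃ b : ℝ, b ≠ 0 ∧
        (∀ x ∈ X, ∀ y ∈ X, f y < f x → f y + b * h y ≤ f x + b * h x) ∧
        ∃ x ∈ X, ∃ y ∈ X, f y < f x ∧ f x + b * h x = f y + b * h y := by
      rcases hne.lt_or_gt with hlt | hgt
      · obtain ⟨t, ht, h1, h2⟩ := exists_first_tie hX ⟨u, hu, v, hv, hf, hlt⟩
        exact ⟨t, ht.ne', h1, h2⟩
      · obtain ⟨t, ht, h1, h2⟩ := exists_first_tie (h := fun z => -h z) hX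
          ⟨u, hu, v, hv, hf, neg_lt_neg hgt⟩
        exact ⟨-t, neg_ne_zero.2 ht.ne', by simpa using h1, by simpa using h2⟩
    refine ⟨1, b, ?_, ?_, fun hall => ?_⟩
    · by_contra! hcon
      refine hfh ⟨(f p + b * h p) / b, -b⁻¹, fun z hz => ?_⟩
      have := hcon z hz p hp
      field_simp
      linarith
    · rintro ⟨r, hr, s, hs, hrs, hlt⟩
      have := hmono r hr s hs hrs
      linarith
    · have := (hall q hq p hp).2 (by linarith)
      linarith

lemma JvisF_add_smul {S A : Type*} [Fintype S] [Fintype A] [DecidableEq S]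
    (T : S → A → S → ℝ) (R R' : S → A → ℝ) (d0 : S → ℝ) (γ a b : ℝ) (π : S → A → ℝ) :
    JvisF T (a • R + b • R') d0 γ π = a * JvisF T R d0 γ π + b * JvisF T R' d0 γ π := by
  simp only [JvisF, Finset.mul_sum, ← Finset.sum_add_distrib, Pi.add_apply, Pi.smul_apply,
    smul_eq_mul, add_mul, mul_assoc]

open Classical in
lemma JvisF_indicator {S A : Type*} [Fintype S] [Fintype A] [DecidableEq S]
    (T : S → A → S → ℝ) (d0 : S → ℝ) (γ : ℝ) (π : S → A → ℝ) (s : S) (a : A) :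
    JvisF T (fun s' a' => if s' = s then if a' = a then 1 else 0 else 0) d0 γ π =
      visitCount T d0 γ π s a := by
  simp [JvisF, ite_mul, Finset.sum_ite_irrel]

/-- **Corrected Theorem 2 of Skalse et al.**: for any finite policy set whose
visit counts are not collinear and any reward function `R₁`, there is a reward
function `R₂` that is non-trivial on the set, such that `(R₁, R₂)` is
unhackable yet the two do not induce the same ordering. -/
theorem stmt17 {S A : Type*} [Fintype S] [Fintype A] [DecidableEq S] [Nonempty S]
    (hA : 1 < Fintype.card A)
    (T : S → A → S → ℝ) (hT : IsTransModel T)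
    (d0 : S → ℝ) (hd0 : IsDist d0)
    (γ : ℝ) (hγ0 : 0 ≤ γ) (hγ1 : γ < 1)
    (Ps : Set (S → A → ℝ)) (hfin : Ps.Finite) (hPs : ∀ p ∈ Ps, IsPolicy p)
    -- the visit counts of `Ps` do NOT all lie on a single line in `ℝ^{S×A}`
    (hncol : ¬ ∃ x u : S → A → ℝ, ∀ π ∈ Ps, ∃ c : ℝ,
      visitCount T d0 γ π = x + c • u)
    (R₁ : S → A → ℝ) :
    ∃ R₂ : S → A → ℝ,
      -- `J_{R₂}` is non-trivial (non-constant) on `Ps`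
      (∃ π ∈ Ps, ∃ π' ∈ Ps, JvisF T R₂ d0 γ π ≠ JvisF T R₂ d0 γ π') ∧
      -- `(R₁, R₂)` is unhackable on `Ps`
      (¬ ∃ π ∈ Ps, ∃ π' ∈ Ps,
        JvisF T R₁ d0 γ π' < JvisF T R₁ d0 γ π ∧
        JvisF T R₂ d0 γ π < JvisF T R₂ d0 γ π') ∧
      -- `J_{R₁}` and `J_{R₂}` do not induce the same ordering on `Ps`
      ¬ ∀ π ∈ Ps, ∀ π' ∈ Ps,
        (JvisF T R₁ d0 γ π' ≤ JvisF T R₁ d0 γ π ↔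
          JvisF T R₂ d0 γ π' ≤ JvisF T R₂ d0 γ π) := by
  classical
  obtain ⟨s, a, hsa⟩ : ∃ s a, ¬ ∃ x u : ℝ, ∀ π ∈ Ps,
      visitCount T d0 γ π s a = x + JvisF T R₁ d0 γ π * u := by
    by_contra! hcon
    choose x u hxu using hcon
    exact hncol ⟨x, u, fun π hπ => ⟨JvisF T R₁ d0 γ π, by
      ext s a
      simpa using hxu s a π hπ⟩⟩
  obtain ⟨c, d, hcd⟩ := exists_combination_unhackable hfin hsa
  refine ⟨c • R₁ + d • fun s' a' => if s' = s then if a' = a then 1 else 0 else 0, ?_⟩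
  simpa only [JvisF_add_smul, JvisF_indicator] using hcd
end
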